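/- Nearest neighbors fast rates under the low-density assumption: assume Z finite, ℓ(z,y) = ⟨ψ(z), φ(y)⟩ with ‖ψ(z)‖ ≤ c_ψ, the low-density condition P_{X∼ρ_X}(d(g*(X),F) < t) ≤ c_α t^α for all t > 0, the sub-exponential moment condition on ρ|_x, the modified Lipschitz condition on g* with exponent β, and that for every x ∈ supp ρ_X the cdf of d(x,X₁) is continuous. With the schedule k_n = ⌊k₀ n^{2β/(2β+1)}⌋ for any k₀ > 0, let f_n be a decoding of the k_n-nearest-neighbor estimate g_n built from n i.i.d. samples of ρ, and f* a decoding of g*. Then there exists b₆ > 0 not depending on n such that for every n ≥ 1: E[R(f_n)] − R(f*) ≤ b₆ n^{−β(α+1)/(2β+1)}. -/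

import Mathlib

open MeasureTheory ProbabilityTheory Real
open scoped RealInnerProductSpace ENNReal


lemma nn_scalar_ineq (q : ℕ) : ∃ C : ℝ, 0 ≤ C ∧ ∀ a b w : ℝ, 0 ≤ a → 0 ≤ b → w ^ 2 ≤ a * b →
    (a + 2 * w + b) ^ (q + 1) ≤ a ^ (q + 1) + 2 * (q + 1) * a ^ q * w
      + C * (a ^ q * b + b ^ (q + 1)) := by
  induction q with
  | zero =>
    refine ⟨1, by norm_num, fun a b w ha hb hw => ?_⟩
    simp; linarith
  | succ q ih =>
    obtain ⟨C, hC, h⟩ := ih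
    refine ⟨1 + 6 * (q + 1) + 6 * C, by positivity, fun a b w ha hb hw => ?_⟩
    have h2w : |2 * w| ≤ a + b := by
      apply abs_le_of_sq_le_sq _ (by positivity)
      nlinarith [sq_nonneg (a - b)]
    obtain ⟨h1, h2⟩ := abs_le.1 h2w
    have hnn : 0 ≤ a + 2 * w + b := by linarith
    have key := mul_le_mul_of_nonneg_right (h a b w ha hb hw) hnn
    have e1 : a ^ q * w ^ 2 ≤ a ^ (q + 1) * b := by
      have := mul_le_mul_of_nonneg_left hw (pow_nonneg ha q)
      calc _ ≤ _ := this
        _ = _ := by ring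
    have e3 : a ^ q * b ^ 2 ≤ a ^ (q + 1) * b + b ^ (q + 2) := by
      rcases le_total a b with hab | hab
      · have := mul_le_mul_of_nonneg_right (pow_le_pow_left₀ ha hab q) (sq_nonneg b)
        have h0 : 0 ≤ a ^ (q + 1) * b := by positivity
        calc _ ≤ _ := this
          _ = b ^ (q + 2) := by ring
          _ ≤ _ := by linarith
      · have := mul_le_mul_of_nonneg_left hab (mul_nonneg (pow_nonneg ha q) hb)
        have h0 : 0 ≤ b ^ (q + 2) := by positivity
        calc _ = a ^ q * b * b := by ring
          _ ≤ _ := this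
          _ = a ^ (q + 1) * b := by ring
          _ ≤ _ := by linarith
    have e4 : a * b ^ (q + 1) ≤ a ^ (q + 1) * b + b ^ (q + 2) := by
      rcases le_total a b with hab | hab
      · have := mul_le_mul_of_nonneg_right hab (pow_nonneg hb (q + 1))
        have h0 : 0 ≤ a ^ (q + 1) * b := by positivity
        calc _ ≤ _ := this
          _ = b ^ (q + 2) := by ring
          _ ≤ _ := by linarith
      · have := mul_le_mul_of_nonneg_left (pow_le_pow_left₀ hb hab q) (mul_nonneg ha hb)
        have h0 : 0 ≤ b ^ (q + 2) := by positivity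
        calc _ = a * b * b ^ q := by ring
          _ ≤ _ := this
          _ = a ^ (q + 1) * b := by ring
          _ ≤ _ := by linarith
    have e2 : a ^ q * (2 * w) * b ≤ a ^ (q + 1) * b + a ^ q * b ^ 2 := by
      have := mul_le_mul_of_nonneg_left h2 (mul_nonneg (pow_nonneg ha q) hb)
      calc _ = a ^ q * b * (2 * w) := by ring
        _ ≤ _ := this
        _ = _ := by ring
    have e5 : (a ^ q * b + b ^ (q + 1)) * (a + 2 * w + b)
        ≤ 6 * (a ^ (q + 1) * b + b ^ (q + 2)) := by
      have : (a ^ q * b + b ^ (q + 1)) * (a + 2 * w + b) ≤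
          (a ^ q * b + b ^ (q + 1)) * (2 * (a + b)) :=
        mul_le_mul_of_nonneg_left (by linarith) (by positivity)
      have e : (a ^ q * b + b ^ (q + 1)) * (2 * (a + b)) =
        2 * (a ^ (q + 1) * b + a ^ q * b ^ 2 + a * b ^ (q + 1) + b ^ (q + 2)) := by ring
      linarith
    have e5' := mul_le_mul_of_nonneg_left e5 hC
    have e1' := mul_le_mul_of_nonneg_left e1 (show (0:ℝ) ≤ 4 * (q + 1) by positivity)
    have e2' := mul_le_mul_of_nonneg_left (e2.trans (add_le_add_right e3 _))
      (show (0:ℝ) ≤ (q + 1) by positivity)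
    have hp : 0 ≤ a ^ (q + 1) * b := by positivity
    have hp2 : 0 ≤ b ^ (q + 2) := by positivity
    have hp3 : 0 ≤ (q:ℝ) * (a ^ (q + 1) * b) := by positivity
    have hp4 : 0 ≤ (q:ℝ) * b ^ (q + 2) := by positivity
    have E : (a ^ (q + 1) + 2 * (q + 1) * a ^ q * w + C * (a ^ q * b + b ^ (q + 1)))
        * (a + 2 * w + b) = a ^ (q + 2) + 2 * (q + 2) * a ^ (q + 1) * w + a ^ (q + 1) * b
        + 4 * (q + 1) * (a ^ q * w ^ 2) + (q + 1) * (a ^ q * (2 * w) * b)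
        + C * ((a ^ q * b + b ^ (q + 1)) * (a + 2 * w + b)) := by ring
    rw [E] at key
    have L : (a + 2 * w + b) ^ (q + 1) * (a + 2 * w + b) = (a + 2 * w + b) ^ (q + 1 + 1) := by ring
    rw [L] at key
    push_cast
    nlinarith

lemma nn_norm_ineq (q : ℕ) : ∃ C : ℝ, 0 ≤ C ∧ ∀ {H : Type*} [NormedAddCommGroup H]
    [InnerProductSpace ℝ H] (s z : H),
    ‖s + z‖ ^ (2 * (q + 1)) ≤ ‖s‖ ^ (2 * (q + 1)) + 2 * (q + 1) * (‖s‖ ^ (2 * q) * ⟪s, z⟫)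
      + C * (‖s‖ ^ (2 * q) * ‖z‖ ^ 2 + ‖z‖ ^ (2 * (q + 1))) := by
  obtain ⟨C, hC, h⟩ := nn_scalar_ineq q
  refine ⟨C, hC, fun s z => ?_⟩
  have := h (‖s‖ ^ 2) (‖z‖ ^ 2) ⟪s, z⟫ (by positivity) (by positivity) (by
    rw [← mul_pow, ← sq_abs]
    exact pow_le_pow_left₀ (abs_nonneg _) (abs_real_inner_le_norm s z) 2)
  rw [← norm_add_sq_real] at this
  simp only [← pow_mul] at this
  linarith

/-- Moments of weighted sums of independent centered vectors. -/
lemma nn_moment {H : Type*} [NormedAddCommGroup H] [InnerProductSpace ℝ H] [CompleteSpace H]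
    [SecondCountableTopology H] [MeasurableSpace H] [BorelSpace H] (B : ℕ → ℝ)
    (hB : ∀ m, 0 ≤ B m) (q : ℕ) :
    ∃ K : ℝ, 0 ≤ K ∧ ∀ {Ω : Type*} {ι : Type} [MeasurableSpace Ω] (P : Measure Ω)
      [IsProbabilityMeasure P] (ζ : ι → Ω → H) (_ : ∀ i, Measurable (ζ i))
      (_ : iIndepFun ζ P) (_ : ∀ i, ∫ ω, ζ i ω ∂P = 0) (_ : ∀ i (m : ℕ), MemLp (ζ i) m P)
      (_ : ∀ i, ∀ m : ℕ, 1 ≤ m → ∫ ω, ‖ζ i ω‖ ^ (2 * m) ∂P ≤ B m) (w : ι → ℝ) (s : Finset ι),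
      ∫ ω, ‖∑ i ∈ s, w i • ζ i ω‖ ^ (2 * q) ∂P ≤ K * (∑ i ∈ s, w i ^ 2) ^ q := by
  classical
  induction q with
  | zero =>
    refine ⟨1, by norm_num, ?_⟩
    intros
    simp
  | succ q ih =>
    obtain ⟨K, hK, ih⟩ := ih
    obtain ⟨C, hC, hineq⟩ := nn_norm_ineq q
    refine ⟨2 * C * (K * B 1 + B (q + 1)), by have := hB 1; have := hB (q+1); positivity, ?_⟩
    intro Ω ι _ P _ ζ hm hind hmean hLp hmom w s
    have hT : ∀ s : Finset ι, ∀ m : ℕ, MemLp (fun ω => ∑ i ∈ s, w i • ζ i ω) m P := by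
      intro s m
      exact memLp_finsetSum _ fun i _ => (hLp i m).const_smul (w i)
    have hTi : ∀ s : Finset ι, ∀ m : ℕ, Integrable (fun ω => ‖∑ i ∈ s, w i • ζ i ω‖ ^ m) P :=
      fun s m => (hT s m).integrable_norm_pow'
    have hzi : ∀ i, ∀ m : ℕ, Integrable (fun ω => ‖ζ i ω‖ ^ m) P :=
      fun i m => (hLp i m).integrable_norm_pow'
    have hTm : ∀ s : Finset ι, Measurable (fun ω => ∑ i ∈ s, w i • ζ i ω) := by
      intro s
      exact Finset.measurable_fun_sum _ fun i _ => (hm i).const_smul (w i)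
    induction s using Finset.induction_on with
    | empty => simp
    | insert a s ha IH =>
      set T : Ω → H := fun ω => ∑ i ∈ s, w i • ζ i ω with hTdef
      have hindT : IndepFun T (ζ a) P := by
        have h1 : iIndepFun (fun i ω => (if i = a then (1:ℝ) else w i) • ζ i ω) P :=
          hind.comp (fun i z => (if i = a then (1:ℝ) else w i) • z)
            (fun i => measurable_id.const_smul _)
        have h2 := h1.indepFun_finsetSum_of_notMem (fun i => (hm i).const_smul _) ha
        convert h2 using 1
        · ext ω
          simp only [hTdef, Finset.sum_apply]
          refine Finset.sum_congr rfl fun i hi => ?_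
          have hia : i ≠ a := by rintro rfl; exact ha hi
          rw [if_neg hia]
        · ext ω; simp
      have hI : ∫ ω, ‖T ω‖ ^ (2 * q) * ⟪T ω, ζ a ω⟫ ∂P = 0 := by
        have hf : Integrable (fun t : H => ‖t‖ ^ (2 * q) • t) (P.map T) := by
          rw [integrable_map_measure (by fun_prop) (hTm s).aemeasurable]
          refine (hTi s (2 * q + 1)).mono' ?_ (Filter.Eventually.of_forall fun ω => ?_)
          · exact (Continuous.measurable (by fun_prop : Continuous
              (fun t : H => ‖t‖ ^ (2 * q) • t))).comp (hTm s) |>.aestronglyMeasurable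
          · simp [norm_smul, pow_succ]
        have hg : Integrable (fun z : H => z) (P.map (ζ a)) := by
          rw [integrable_map_measure (by fun_prop) (hm a).aemeasurable]
          exact (hLp a 1).integrable (by simp)
        have := hindT.integral_bilin_comp_comp (hTm s).aemeasurable (hm a).aemeasurable
          hf hg (innerSL ℝ)
        have h2 : ∫ ω, ⟪‖T ω‖ ^ (2 * q) • T ω, ζ a ω⟫ ∂P
          = ⟪∫ ω, ‖T ω‖ ^ (2 * q) • T ω ∂P, ∫ ω, ζ a ω ∂P⟫ := this
        simp only [real_inner_smul_left] at h2
        rw [h2, hmean a, inner_zero_right]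
      have hI2 : ∫ ω, ‖T ω‖ ^ (2 * q) * ‖ζ a ω‖ ^ 2 ∂P
          = (∫ ω, ‖T ω‖ ^ (2 * q) ∂P) * ∫ ω, ‖ζ a ω‖ ^ 2 ∂P :=
        hindT.integral_fun_comp_mul_comp (hTm s).aemeasurable (hm a).aemeasurable
          (f := fun t => ‖t‖ ^ (2 * q)) (g := fun z => ‖z‖ ^ 2)
          (by fun_prop) (by fun_prop)
      have hTm' : Measurable T := hTm s
      have hma := hm a
      have i1 : Integrable (fun ω => ‖T ω‖ ^ (2 * q) * ⟪T ω, ζ a ω⟫) P := by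
        refine ((hTi s (2 * (2 * q + 1))).add (hzi a 2)).mono'
          (by fun_prop) (Filter.Eventually.of_forall fun ω => ?_)
        rw [norm_mul, norm_pow, norm_norm, Real.norm_eq_abs]
        have h1 := mul_le_mul_of_nonneg_left (abs_real_inner_le_norm (T ω) (ζ a ω))
          (show 0 ≤ ‖T ω‖ ^ (2 * q) by positivity)
        refine h1.trans ?_
        change _ ≤ ‖T ω‖ ^ (2 * (2 * q + 1)) + ‖ζ a ω‖ ^ 2
        have e : ‖T ω‖ ^ (2 * (2 * q + 1)) = (‖T ω‖ ^ (2 * q) * ‖T ω‖) ^ 2 := by ring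
        rw [e, ← mul_assoc]
        nlinarith [sq_nonneg (‖T ω‖ ^ (2 * q) * ‖T ω‖ - ‖ζ a ω‖),
          sq_nonneg (‖T ω‖ ^ (2 * q) * ‖T ω‖ + ‖ζ a ω‖)]
      have i2 : Integrable (fun ω => ‖T ω‖ ^ (2 * q) * ‖ζ a ω‖ ^ 2) P := by
        refine ((hTi s (2 * (2 * q))).add (hzi a 4)).mono'
          (by fun_prop) (Filter.Eventually.of_forall fun ω => ?_)
        rw [norm_mul, norm_pow, norm_norm, norm_pow, norm_norm]
        change _ ≤ ‖T ω‖ ^ (2 * (2 * q)) + ‖ζ a ω‖ ^ 4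
        have e : ‖T ω‖ ^ (2 * (2 * q)) = (‖T ω‖ ^ (2 * q)) ^ 2 := by ring
        rw [e]
        nlinarith [sq_nonneg (‖T ω‖ ^ (2 * q) - ‖ζ a ω‖ ^ 2),
          sq_nonneg (‖T ω‖ ^ (2 * q) + ‖ζ a ω‖ ^ 2)]
      have i0 : Integrable (fun ω => ‖T ω‖ ^ (2 * (q + 1))) P := hTi s (2 * (q + 1))
      have i3 := hzi a (2 * (q + 1))
      have step : ∫ ω, ‖∑ i ∈ insert a s, w i • ζ i ω‖ ^ (2 * (q + 1)) ∂P ≤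
          ∫ ω, (‖T ω‖ ^ (2 * (q + 1)) + (2 * (q + 1) * w a) * (‖T ω‖ ^ (2 * q) * ⟪T ω, ζ a ω⟫)
            + (C * w a ^ 2 * (‖T ω‖ ^ (2 * q) * ‖ζ a ω‖ ^ 2)
              + C * w a ^ (2 * (q + 1)) * ‖ζ a ω‖ ^ (2 * (q + 1)))) ∂P := by
        refine integral_mono (hTi _ _) ((i0.add (i1.const_mul _)).add
          ((i2.const_mul _).add (i3.const_mul _))) fun ω => ?_
        have := hineq (T ω) (w a • ζ a ω)
        simp only [Finset.sum_insert ha]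
        rw [add_comm (w a • ζ a ω)]
        refine this.trans (le_of_eq ?_)
        simp only [norm_smul, real_inner_smul_right, mul_pow, Real.norm_eq_abs,
          pow_mul |w a| 2, sq_abs]
        ring
      have jA : Integrable (fun ω => ‖T ω‖ ^ (2 * (q + 1))
          + (2 * (q + 1) * w a) * (‖T ω‖ ^ (2 * q) * ⟪T ω, ζ a ω⟫)) P := i0.add (i1.const_mul _)
      have jB : Integrable (fun ω => C * w a ^ 2 * (‖T ω‖ ^ (2 * q) * ‖ζ a ω‖ ^ 2)
              + C * w a ^ (2 * (q + 1)) * ‖ζ a ω‖ ^ (2 * (q + 1))) P :=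
        (i2.const_mul _).add (i3.const_mul _)
      rw [integral_add jA jB,
        integral_add i0 (i1.const_mul _), integral_add (i2.const_mul _) (i3.const_mul _),
        integral_const_mul, integral_const_mul, integral_const_mul, hI, hI2] at step
      refine step.trans ?_
      have IH2 := ih P ζ hm hind hmean hLp hmom w s
      rw [Finset.sum_insert ha]
      set V := ∑ i ∈ s, w i ^ 2 with hV
      have hV0 : 0 ≤ V := Finset.sum_nonneg fun i _ => sq_nonneg _
      set u := w a ^ 2 with hu
      have hu0 : 0 ≤ u := sq_nonneg _
      have hwu : w a ^ (2 * (q + 1)) = u ^ (q + 1) := by rw [pow_mul]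
      rw [hwu]
      have hm1 : ∫ ω, ‖ζ a ω‖ ^ 2 ∂P ≤ B 1 := hmom a 1 le_rfl
      have hmq := hmom a (q + 1) (by omega)
      have hz0 : 0 ≤ ∫ ω, ‖ζ a ω‖ ^ 2 ∂P := integral_nonneg fun _ => by positivity
      have p1 : (∫ ω, ‖T ω‖ ^ (2 * q) ∂P) * ∫ ω, ‖ζ a ω‖ ^ 2 ∂P ≤ K * V ^ q * B 1 :=
        mul_le_mul IH2 hm1 hz0 (by positivity)
      have p2 := mul_le_mul_of_nonneg_left p1 (show 0 ≤ C * u by positivity)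
      have p3 := mul_le_mul_of_nonneg_left hmq (show 0 ≤ C * u ^ (q + 1) by positivity)
      have q1 : V ^ (q + 1) + V ^ q * u ≤ (u + V) ^ (q + 1) := by
        have := mul_le_mul_of_nonneg_right (pow_le_pow_left₀ hV0 (by linarith : V ≤ u + V) q)
          (by linarith : 0 ≤ u + V)
        calc _ = V ^ q * (u + V) := by ring
          _ ≤ _ := this
          _ = _ := by ring
      have q2 : V ^ (q + 1) + u ^ (q + 1) ≤ (u + V) ^ (q + 1) := by
        rw [add_comm u V]
        exact pow_add_pow_le hV0 hu0 (by omega)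
      have hb1 := hB 1
      have hbq := hB (q + 1)
      have q1' := mul_le_mul_of_nonneg_left q1 (show 0 ≤ C * (K * B 1) by positivity)
      have q2' := mul_le_mul_of_nonneg_left q2 (show 0 ≤ C * B (q + 1) by positivity)
      have q3 : V ^ (q + 1) ≤ (u + V) ^ (q + 1) := by
        have : 0 ≤ V ^ q * u := by positivity
        linarith
      have q3' := mul_le_mul_of_nonneg_left q3 (show 0 ≤ C * (K * B 1) by positivity)
      have q3'' := mul_le_mul_of_nonneg_left q3 (show 0 ≤ C * B (q + 1) by positivity)
      nlinarith [IH]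


lemma nn_measurable_pi {X Y : Type*} [MeasurableSpace X] [MeasurableSpace Y]
    (κ : Kernel X Y) [IsMarkovKernel κ] (n : ℕ) :
    Measurable (fun v : Fin n → X => Measure.pi fun i => (κ (v i)).map (Prod.mk (v i))) := by
  have : ∀ v : Fin n → X, ∀ i, IsProbabilityMeasure ((κ (v i)).map (Prod.mk (v i))) :=
    fun v i => Measure.isProbabilityMeasure_map (by fun_prop)
  refine Measurable.measure_of_isPiSystem_of_isProbabilityMeasure
    (S := Set.pi Set.univ '' Set.pi Set.univ fun _ : Fin n => {s : Set (X × Y) | MeasurableSet s})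
    generateFrom_pi.symm isPiSystem_pi ?_
  rintro _ ⟨s, hs, rfl⟩
  simp only [Measure.pi_pi]
  refine Finset.measurable_fun_prod _ fun i _ => ?_
  have hsi : MeasurableSet (s i) := hs i (Set.mem_univ _)
  have : (fun v : Fin n → X => (κ (v i)).map (Prod.mk (v i)) (s i))
      = fun v => κ (v i) (Prod.mk (v i) ⁻¹' s i) := by
    ext v
    rw [Measure.map_apply (by fun_prop) hsi]
  rw [this]
  exact (Kernel.measurable_kernel_prodMk_left hsi).comp (measurable_pi_apply i)

lemma nn_pi_eq_bind {X Y : Type*} [MeasurableSpace X] [MeasurableSpace Y]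
    (μ : Measure X) [IsProbabilityMeasure μ] (κ : Kernel X Y) [IsMarkovKernel κ] (n : ℕ) :
    Measure.pi (fun _ : Fin n => μ ⊗ₘ κ) = (Measure.pi fun _ : Fin n => μ).bind
      (fun v => Measure.pi fun i => (κ (v i)).map (Prod.mk (v i))) := by
  have : ∀ v : Fin n → X, ∀ i, IsProbabilityMeasure ((κ (v i)).map (Prod.mk (v i))) :=
    fun v i => Measure.isProbabilityMeasure_map (by fun_prop)
  refine Measure.pi_eq fun s hs => ?_
  rw [Measure.bind_apply (MeasurableSet.univ_pi hs) (nn_measurable_pi κ n).aemeasurable]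
  simp only [Measure.pi_pi]
  have h1 : ∀ v : Fin n → X, ∏ i, (κ (v i)).map (Prod.mk (v i)) (s i)
      = ∏ i, κ (v i) (Prod.mk (v i) ⁻¹' s i) := fun v =>
    Finset.prod_congr rfl fun i _ => Measure.map_apply (by fun_prop) (hs i)
  simp only [h1]
  have hmeas : ∀ i, Measurable fun x => κ x (Prod.mk x ⁻¹' s i) :=
    fun i => Kernel.measurable_kernel_prodMk_left (hs i)
  have h2 := lintegral_prod_eq_prod_lintegral_of_indepFun (μ := Measure.pi fun _ : Fin n => μ)
    Finset.univ (fun i (v : Fin n → X) => κ (v i) (Prod.mk (v i) ⁻¹' s i))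
    (iIndepFun_pi (fun i => (hmeas i).aemeasurable))
    (fun i => (hmeas i).comp (measurable_pi_apply i))
  rw [h2]
  refine Finset.prod_congr rfl fun i _ => ?_
  rw [Measure.compProd_apply (hs i)]
  have := (measurePreserving_eval (fun _ : Fin n => μ) i).lintegral_comp (hmeas i)
  exact this

lemma nn_noise_tail {X Y H : Type*} [MeasurableSpace X] [MeasurableSpace Y]
    [NormedAddCommGroup H] [InnerProductSpace ℝ H] [CompleteSpace H]
    [SecondCountableTopology H] [MeasurableSpace H] [BorelSpace H]
    (μ : Measure X) [IsProbabilityMeasure μ] (κ : Kernel X Y) [IsMarkovKernel κ]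
    (φ : Y → H) (hφ : Measurable φ) (g : X → H) (hg : Measurable g) (S : Set X)
    (hS : ∀ᵐ x ∂μ, x ∈ S) (B : ℕ → ℝ) (hB : ∀ m, 0 ≤ B m)
    (hmean : ∀ x ∈ S, ∫ y, (φ y - g x) ∂(κ x) = 0)
    (hLp : ∀ x ∈ S, ∀ m : ℕ, MemLp (fun y => φ y - g x) m (κ x))
    (hmom : ∀ x ∈ S, ∀ m : ℕ, 1 ≤ m → ∫ y, ‖φ y - g x‖ ^ (2 * m) ∂(κ x) ≤ B m) (q : ℕ) :
    ∃ K : ℝ, 0 ≤ K ∧ ∀ (n : ℕ) (W : (Fin n → X) → Fin n → ℝ) (_ : ∀ i, Measurable fun v => W v i)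
      (V : ℝ) (_ : ∀ᵐ v ∂(Measure.pi fun _ : Fin n => μ), ∑ i, W v i ^ 2 ≤ V) (a : ℝ) (_ : 0 < a),
      Measure.pi (fun _ : Fin n => μ ⊗ₘ κ)
        {D | a ≤ ‖∑ i, W (fun j => (D j).1) i • (φ (D i).2 - g (D i).1)‖}
        ≤ ENNReal.ofReal (K * V ^ q / a ^ (2 * q)) := by
  obtain ⟨K, hK, h⟩ := nn_moment (H := H) B hB q
  refine ⟨K, hK, fun n W hW V hV a ha => ?_⟩
  have hms : MeasurableSet
      {D : Fin n → X × Y | a ≤ ‖∑ i, W (fun j => (D j).1) i • (φ (D i).2 - g (D i).1)‖} := by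
    refine measurableSet_le measurable_const (Measurable.norm ?_)
    refine Finset.measurable_fun_sum _ fun i _ => ?_
    refine Measurable.smul ((hW i).comp (by fun_prop)) (by fun_prop)
  rw [nn_pi_eq_bind, Measure.bind_apply hms (nn_measurable_pi κ n).aemeasurable]
  have hSv : ∀ᵐ v ∂(Measure.pi fun _ : Fin n => μ), ∀ i, v i ∈ S := by
    rw [ae_all_iff]
    intro i
    exact (measurePreserving_eval (fun _ : Fin n => μ) i).quasiMeasurePreserving.ae hS
  calc _ ≤ ∫⁻ v, ENNReal.ofReal (K * V ^ q / a ^ (2 * q)) ∂(Measure.pi fun _ : Fin n => μ) := by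
        refine lintegral_mono_ae ?_
        filter_upwards [hV, hSv] with v hv hs
        rw [← Measure.pi_map_pi (μ := fun i => κ (v i)) (f := fun i => Prod.mk (v i))
          (fun i => by fun_prop), Measure.map_apply (by fun_prop) hms]
        set P := Measure.pi fun i => κ (v i)
        have hmp := fun i => measurePreserving_eval (fun i => κ (v i)) i
        have hc : ∀ i, ∀ m : ℕ, MemLp (fun y : Fin n → Y => φ (y i) - g (v i)) (m : ℝ≥0∞) P := by
          intro i m
          exact (hLp (v i) (hs i) m).comp_measurePreserving (hmp i)
        have hc2 : MemLp (fun y : Fin n → Y => ∑ i, W v i • (φ (y i) - g (v i)))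
            ((2 * q : ℕ) : ℝ≥0∞) P :=
          memLp_finsetSum _ fun i _ => MemLp.const_smul (hc i _) _
        have key := h P (fun i y => φ (y i) - g (v i)) (fun i => by fun_prop)
          (iIndepFun_pi (X := fun i y => φ y - g (v i)) (fun i => by fun_prop)) (fun i => ?_)
          (fun i m => ?_) (fun i m hm => ?_) (W v) Finset.univ
        · have mk := mul_meas_ge_le_integral_of_nonneg (μ := P)
            (f := fun y => ‖∑ i, W v i • (φ (y i) - g (v i))‖ ^ (2 * q))
            (Filter.Eventually.of_forall fun _ => by positivity) ?_ (a ^ (2 * q))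
          · rw [← ofReal_measureReal]
            refine ENNReal.ofReal_le_ofReal ?_
            rw [le_div_iff₀ (by positivity), mul_comm]
            refine le_trans ?_ (mk.trans (key.trans ?_))
            · refine mul_le_mul_of_nonneg_left ?_ (by positivity)
              refine measureReal_mono ?_
              intro y hy
              exact pow_le_pow_left₀ ha.le hy _
            · exact mul_le_mul_of_nonneg_left (pow_le_pow_left₀
                (Finset.sum_nonneg fun i _ => sq_nonneg _) hv q) hK
          · exact hc2.integrable_norm_pow'
        · rw [← hmean (v i) (hs i), ← (hmp i).map_eq, integral_map (measurable_pi_apply i).aemeasurable (by fun_prop)]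
        · exact hc i m
        · refine le_trans (le_of_eq ?_) (hmom (v i) (hs i) m hm)
          conv_rhs => rw [← (hmp i).map_eq, integral_map (measurable_pi_apply i).aemeasurable (by fun_prop)]
    _ = _ := by simp

lemma nn_chernoff {X : Type*} [MeasurableSpace X] (μ : Measure X) [IsProbabilityMeasure μ]
    (S : Set X) (hS : MeasurableSet S) [DecidablePred (· ∈ S)] (n k : ℕ) :
    Measure.pi (fun _ : Fin n => μ) {v | (Finset.univ.filter fun j => v j ∈ S).card < k}
      ≤ ENNReal.ofReal (exp (k - n * μ.real S / 2)) := by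
  set P := Measure.pi (fun _ : Fin n => μ)
  set f : X → ℝ := fun x => exp (- S.indicator 1 x) with hf
  have hfm : Measurable f := by
    have : Measurable (S.indicator (1 : X → ℝ)) := measurable_one.indicator hS
    fun_prop
  have hf1 : ∀ x, f x ≤ 1 := fun x => by
    simp only [hf]
    rw [exp_le_one_iff]
    have : 0 ≤ S.indicator (1 : X → ℝ) x := Set.indicator_nonneg (fun _ _ => zero_le_one) _
    linarith
  have hf0 : ∀ x, 0 ≤ f x := fun x => (exp_pos _).le
  have hE : ∫ x, f x ∂μ ≤ exp (-(μ.real S / 2)) := by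
    have h1 : ∀ x, f x ≤ 1 - S.indicator (fun _ => (1/2 : ℝ)) x := by
      intro x
      simp only [hf]
      by_cases hx : x ∈ S
      · simp only [Set.indicator_of_mem hx, Pi.one_apply]
        have := exp_one_gt_d9
        rw [exp_neg]
        have : (exp 1)⁻¹ ≤ 2⁻¹ := by
          gcongr
          linarith
        linarith
      · simp [Set.indicator_of_notMem hx]
    have hint : Integrable (S.indicator (fun _ => (1/2 : ℝ))) μ :=
      (integrable_const _).indicator hS
    have h2 : ∫ x, f x ∂μ ≤ ∫ x, (1 - S.indicator (fun _ => (1/2 : ℝ)) x) ∂μ := by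
      refine integral_mono ?_ ((integrable_const _).sub hint) h1
      exact Integrable.of_bound hfm.aestronglyMeasurable 1
        (Filter.Eventually.of_forall fun x => by rw [Real.norm_eq_abs, abs_of_nonneg (hf0 x)]; exact hf1 x)
    rw [integral_sub (integrable_const _) hint, integral_indicator_const _ hS] at h2
    simp only [integral_const, probReal_univ, smul_eq_mul] at h2
    have := add_one_le_exp (-(μ.real S / 2))
    linarith
  have hpow := integral_fintype_prod_eq_pow (ι := Fin n) f (μ := μ)
  have mk := mul_meas_ge_le_integral_of_nonneg (μ := P)
    (f := fun v => ∏ i, f (v i))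
    (Filter.Eventually.of_forall fun v => Finset.prod_nonneg fun i _ => hf0 _) (by
      refine Integrable.of_bound (Measurable.aestronglyMeasurable ?_) 1
        (Filter.Eventually.of_forall fun v => ?_)
      · exact Finset.measurable_fun_prod _ fun i _ => hfm.comp (measurable_pi_apply i)
      · rw [Real.norm_eq_abs, abs_of_nonneg (Finset.prod_nonneg fun i _ => hf0 _)]
        exact Finset.prod_le_one (fun i _ => hf0 _) fun i _ => hf1 _) (exp (-k))
  rw [hpow] at mk
  rw [← ofReal_measureReal]
  refine ENNReal.ofReal_le_ofReal ?_
  have hsub : P.real {v | (Finset.univ.filter fun j => v j ∈ S).card < k}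
      ≤ P.real {v | exp (-k) ≤ ∏ i, f (v i)} := by
    refine measureReal_mono fun v hv => ?_
    simp only [Set.mem_ofPred_eq, hf] at hv ⊢
    rw [← exp_sum, exp_le_exp, Finset.sum_neg_distrib, neg_le_neg_iff]
    have : ∑ i, S.indicator (1 : X → ℝ) (v i)
        = ((Finset.univ.filter fun j => v j ∈ S).card : ℝ) := by
      simp [Set.indicator_apply]
    rw [this]
    exact_mod_cast hv.le
  have h3 : (∫ x, f x ∂μ) ^ n ≤ exp (-(n * μ.real S / 2)) := by
    calc _ ≤ exp (-(μ.real S / 2)) ^ n := pow_le_pow_left₀ (integral_nonneg hf0) hE n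
      _ = _ := by rw [← exp_nat_mul]; congr 1; ring
  rw [Fintype.card_fin] at mk
  have h4 := mul_le_mul_of_nonneg_left (mk.trans h3) (exp_pos (k:ℝ)).le
  rw [← mul_assoc, ← exp_add, ← exp_add] at h4
  simp only [add_neg_cancel, exp_zero, one_mul] at h4
  exact hsub.trans (h4.trans (le_of_eq (by ring_nf)))

noncomputable section

variable {X Y Z H : Type*}
variable [MetricSpace X] [TopologicalSpace.SeparableSpace X] [MeasurableSpace X] [BorelSpace X]
variable [MeasurableSpace Y] [StandardBorelSpace Y]
variable [Fintype Z] [Nonempty Z] [MeasurableSpace Z] [MeasurableSingletonClass Z]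
variable [NormedAddCommGroup H] [InnerProductSpace ℝ H] [CompleteSpace H]
variable [SecondCountableTopology H] [MeasurableSpace H] [BorelSpace H]

/-- The risk of a predictor `f : X → Z` for the loss `ℓ(z, y) = ⟪ψ z, φ y⟫`. -/
def risk (ψ : Z → H) (φ : Y → H) (ρ : Measure (X × Y)) (f : X → Z) : ℝ :=
  ∫ p, ⟪ψ (f p.1), φ p.2⟫ ∂ρ

/-- The surrogate conditional mean `g*(x) = E_{Y ∼ ρ|ₓ}[φ(Y)]`, where `κ x = ρ|ₓ`. -/
def gStar (φ : Y → H) (κ : Kernel X Y) (x : X) : H :=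
  ∫ y, φ y ∂(κ x)

/-- `f` is a (measurable) decoding of `g : X → H`. -/
def IsDecoding (ψ : Z → H) (g : X → H) (f : X → Z) : Prop :=
  Measurable f ∧ ∀ x z, ⟪ψ (f x), g x⟫ ≤ ⟪ψ z, g x⟫

/-- The decision frontier `F`. -/
def decisionFrontier (ψ : Z → H) : Set H :=
  {ξ | ∃ z₁ z₂ : Z, z₁ ≠ z₂ ∧ (∀ z, ⟪ψ z₁, ξ⟫ ≤ ⟪ψ z, ξ⟫) ∧ ∀ z, ⟪ψ z₂, ξ⟫ ≤ ⟪ψ z, ξ⟫}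

/-- Distance (in `ℝ≥0∞`) from a point to the decision frontier. -/
def dF (ψ : Z → H) (ξ : H) : ℝ≥0∞ :=
  EMetric.infEdist ξ (decisionFrontier ψ)

/-- The (topological) support of a measure. -/
def msupp {W : Type*} [TopologicalSpace W] [MeasurableSpace W] (μ : Measure W) : Set W :=
  {x | ∀ U : Set W, IsOpen U → x ∈ U → 0 < μ U}

/-- The `k`-nearest-neighbor weights at `x`, relative to sample points `v 0, …, v (n-1)`. -/
def nnWeight (n k : ℕ) (v : Fin n → X) (x : X) (i : Fin n) : ℝ :=
  if (Finset.univ.filter fun j => dist x (v j) ≤ dist x (v i)).card < k then 1 / k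
  else if k ≤ (Finset.univ.filter fun j => dist x (v j) < dist x (v i)).card then 0
  else 1 / (((Finset.univ.filter fun j => dist x (v j) = dist x (v i)).card : ℝ) * k)

/-- The `k`-nearest-neighbor estimate of the surrogate conditional mean, built from the
dataset `D`. -/
def gNN (φ : Y → H) (n k : ℕ) (D : Fin n → X × Y) (x : X) : H :=
  ∑ i, nnWeight n k (fun j => (D j).1) x i • φ (D i).2

set_option linter.unusedSectionVars false

lemma nn_le_card (n : ℕ) (d : Fin n → ℝ) (hinj : Function.Injective d) (i : Fin n) :
    (Finset.univ.filter fun j => d j ≤ d i).card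
      = (Finset.univ.filter fun j => d j < d i).card + 1 := by
  classical
  have : (Finset.univ.filter fun j => d j ≤ d i)
      = insert i (Finset.univ.filter fun j => d j < d i) := by
    ext j
    simp only [Finset.mem_filter, Finset.mem_univ, true_and, Finset.mem_insert]
    rw [le_iff_lt_or_eq, hinj.eq_iff, or_comm]
  rw [this, Finset.card_insert_of_notMem (by simp)]

lemma nn_rank_count (n k : ℕ) (hk : k ≤ n) (d : Fin n → ℝ) (hinj : Function.Injective d) :
    (Finset.univ.filter fun i => (Finset.univ.filter fun j => d j < d i).card < k).card = k := by
  classical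
  have hlt : ∀ i, (Finset.univ.filter fun j => d j < d i).card < n := by
    intro i
    have := Finset.card_le_univ (Finset.univ.filter fun j => d j ≤ d i)
    rw [nn_le_card n d hinj i, Fintype.card_fin] at this
    omega
  set r : Fin n → Fin n := fun i => ⟨(Finset.univ.filter fun j => d j < d i).card, hlt i⟩ with hr
  have hmono : ∀ i j, d i < d j → r i < r j := by
    intro i j hij
    rw [Fin.lt_def]
    simp only [hr]
    have h1 := nn_le_card n d hinj i
    have h2 : (Finset.univ.filter fun l => d l ≤ d i) ⊆ (Finset.univ.filter fun l => d l < d j) := by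
      intro l hl
      simp only [Finset.mem_filter, Finset.mem_univ, true_and] at hl ⊢
      exact hl.trans_lt hij
    have := Finset.card_le_card h2
    omega
  have hrinj : Function.Injective r := by
    intro i j hij
    by_contra hne
    rcases lt_or_gt_of_ne (hinj.ne hne) with h | h
    · exact absurd hij (hmono _ _ h).ne
    · exact absurd hij (hmono _ _ h).ne'
  have hrbij : Function.Bijective r := Finite.injective_iff_bijective.1 hrinj
  have : (Finset.univ.filter fun i => (Finset.univ.filter fun j => d j < d i).card < k).card
      = (Finset.univ.filter fun i : Fin n => (i : ℕ) < k).card := by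
    refine Finset.card_bij (fun i _ => r i) ?_ ?_ ?_
    · intro i hi
      simpa [hr] using hi
    · intro i _ j _ h
      exact hrinj h
    · intro b hb
      obtain ⟨a, rfl⟩ := hrbij.2 b
      exact ⟨a, by simpa [hr] using hb, rfl⟩
  rw [this, Fin.card_filter_val_lt]
  omega

lemma nnWeight_inj (n k : ℕ) (v : Fin n → X) (x : X)
    (hinj : Function.Injective fun j => dist x (v j)) (i : Fin n) :
    nnWeight n k v x i
      = if (Finset.univ.filter fun j => dist x (v j) < dist x (v i)).card < k then 1 / (k : ℝ)
        else 0 := by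
  have h1 := nn_le_card n _ hinj i
  have h2 : (Finset.univ.filter fun j => dist x (v j) = dist x (v i)).card = 1 := by
    rw [Finset.card_eq_one]
    refine ⟨i, ?_⟩
    ext j
    simp only [Finset.mem_filter, Finset.mem_univ, true_and, Finset.mem_singleton]
    exact hinj.eq_iff
  unfold nnWeight
  rw [h1, h2]
  split_ifs <;> first | omega | simp

lemma nnWeight_sum (n k : ℕ) (hk1 : 1 ≤ k) (hk : k ≤ n) (v : Fin n → X) (x : X)
    (hinj : Function.Injective fun j => dist x (v j)) :
    ∑ i, nnWeight n k v x i = 1 := by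
  have hk0 : (k : ℝ) ≠ 0 := by positivity
  simp only [nnWeight_inj n k v x hinj]
  rw [← Finset.sum_filter, Finset.sum_const, nn_rank_count n k hk _ hinj]
  simp [hk0]

lemma nnWeight_sum_sq (n k : ℕ) (hk1 : 1 ≤ k) (hk : k ≤ n) (v : Fin n → X) (x : X)
    (hinj : Function.Injective fun j => dist x (v j)) :
    ∑ i, nnWeight n k v x i ^ 2 = 1 / k := by
  have hk0 : (k : ℝ) ≠ 0 := by positivity
  simp only [nnWeight_inj n k v x hinj, ite_pow]
  rw [show (0:ℝ) ^ 2 = 0 by norm_num, ← Finset.sum_filter, Finset.sum_const,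
    nn_rank_count n k hk _ hinj]
  simp; field_simp

lemma nnWeight_measurable (n k : ℕ) (x : X) (i : Fin n) :
    Measurable fun v : Fin n → X => nnWeight n k v x i := by
  have hd : ∀ j : Fin n, Measurable fun v : Fin n → X => dist x (v j) := fun j =>
    (continuous_const.dist continuous_id).measurable.comp (measurable_pi_apply j)
  have hc1 : Measurable fun v : Fin n → X =>
      (Finset.univ.filter fun j => dist x (v j) ≤ dist x (v i)).card := by
    simp only [Finset.card_filter]
    exact Finset.measurable_fun_sum _ fun j _ =>
      Measurable.ite (measurableSet_le (hd j) (hd i)) measurable_const measurable_const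
  have hc2 : Measurable fun v : Fin n → X =>
      (Finset.univ.filter fun j => dist x (v j) < dist x (v i)).card := by
    simp only [Finset.card_filter]
    exact Finset.measurable_fun_sum _ fun j _ =>
      Measurable.ite (measurableSet_lt (hd j) (hd i)) measurable_const measurable_const
  have hc3 : Measurable fun v : Fin n → X =>
      (Finset.univ.filter fun j => dist x (v j) = dist x (v i)).card := by
    simp only [Finset.card_filter]
    exact Finset.measurable_fun_sum _ fun j _ =>
      Measurable.ite (measurableSet_eq_fun (hd j) (hd i)) measurable_const measurable_const
  unfold nnWeight
  refine Measurable.ite (measurableSet_lt hc1 measurable_const) measurable_const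
    (Measurable.ite (measurableSet_le measurable_const hc2) measurable_const ?_)
  have : Measurable fun v : Fin n → X =>
      ((Finset.univ.filter fun j => dist x (v j) = dist x (v i)).card : ℝ) :=
    measurable_from_top.comp hc3
  exact measurable_const.div (this.mul_const _)

lemma nn_sphere_null (μ : Measure X) [IsProbabilityMeasure μ] (x : X)
    (hc : Continuous fun t : ℝ => (μ {u | dist x u ≤ t}).toReal) (r : ℝ) :
    μ {u | dist x u = r} = 0 := by
  have hdm : Measurable fun u => dist x u := (continuous_const.dist continuous_id).measurable
  have hle : ∀ t < r, (μ {u | dist x u = r}).toReal ≤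
      (μ {u | dist x u ≤ r}).toReal - (μ {u | dist x u ≤ t}).toReal := by
    intro t ht
    have h1 : μ {u | dist x u = r} + μ {u | dist x u ≤ t} ≤ μ {u | dist x u ≤ r} := by
      rw [← measure_union _ (measurableSet_le hdm measurable_const)]
      · refine measure_mono ?_
        rintro u (h | h)
        · exact le_of_eq h
        · exact le_trans h ht.le
      · rw [Set.disjoint_left]
        intro u h1 h2
        have h1' : dist x u = r := h1
        have h2' : dist x u ≤ t := h2
        linarith
    have := ENNReal.toReal_mono (measure_ne_top _ _) h1
    rw [ENNReal.toReal_add (measure_ne_top _ _) (measure_ne_top _ _)] at this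
    linarith
  have hlim : Filter.Tendsto (fun t => (μ {u | dist x u ≤ r}).toReal
      - (μ {u | dist x u ≤ t}).toReal) (nhdsWithin r (Set.Iio r)) (nhds 0) := by
    have h : Continuous fun t => (μ {u | dist x u ≤ r}).toReal - (μ {u | dist x u ≤ t}).toReal :=
      continuous_const.sub hc
    have := (h.tendsto r).mono_left (nhdsWithin_le_nhds (s := Set.Iio r))
    simpa using this
  have h0 : (μ {u | dist x u = r}).toReal ≤ 0 :=
    ge_of_tendsto hlim (by filter_upwards [self_mem_nhdsWithin] with t ht using hle t ht)
  have := le_antisymm h0 ENNReal.toReal_nonneg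
  rcases (ENNReal.toReal_eq_zero_iff _).1 this with h | h
  · exact h
  · exact absurd h (measure_ne_top _ _)

lemma nn_ae_inj (μ : Measure X) [IsProbabilityMeasure μ] (x : X)
    (hc : Continuous fun t : ℝ => (μ {u | dist x u ≤ t}).toReal) (n : ℕ) :
    ∀ᵐ v ∂(Measure.pi fun _ : Fin n => μ), Function.Injective fun j => dist x (v j) := by
  have hdm : Measurable fun u => dist x u := (continuous_const.dist continuous_id).measurable
  have key : ∀ i j : Fin n, i ≠ j →
      ∀ᵐ v ∂(Measure.pi fun _ : Fin n => μ), dist x (v i) ≠ dist x (v j) := by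
    intro i j hij
    have hind : IndepFun (fun v : Fin n → X => v i) (fun v => v j) (Measure.pi fun _ => μ) :=
      (iIndepFun_pi (X := fun _ (u : X) => u) (fun _ => aemeasurable_id)).indepFun hij
    have hmap := hind.map_prod_eq_prod_map_map (measurable_pi_apply i).aemeasurable
      (measurable_pi_apply j).aemeasurable
    have hi : (Measure.pi fun _ : Fin n => μ).map (fun v => v i) = μ :=
      (measurePreserving_eval (fun _ : Fin n => μ) i).map_eq
    have hj : (Measure.pi fun _ : Fin n => μ).map (fun v => v j) = μ :=
      (measurePreserving_eval (fun _ : Fin n => μ) j).map_eq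
    rw [hi, hj] at hmap
    have hms : MeasurableSet {p : X × X | dist x p.1 = dist x p.2} :=
      measurableSet_eq_fun (hdm.comp measurable_fst) (hdm.comp measurable_snd)
    have h0 : (μ.prod μ) {p : X × X | dist x p.1 = dist x p.2} = 0 := by
      rw [Measure.measure_prod_null hms]
      refine Filter.Eventually.of_forall fun a => ?_
      have := nn_sphere_null μ x hc (dist x a)
      simp only [Set.preimage_ofPred_eq, Pi.zero_apply]
      convert this using 3
      funext u
      exact propext eq_comm
    rw [← hmap, Measure.map_apply (by fun_prop) hms] at h0
    exact measure_eq_zero_iff_ae_notMem.1 h0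
  have : ∀ᵐ v ∂(Measure.pi fun _ : Fin n => μ), ∀ i j : Fin n, i ≠ j →
      dist x (v i) ≠ dist x (v j) := by
    rw [ae_all_iff]; intro i
    rw [ae_all_iff]; intro j
    by_cases hij : i = j
    · simp [hij]
    · filter_upwards [key i j hij] with v hv _ using hv
  filter_upwards [this] with v hv i j h
  by_contra hne
  exact hv i j hne h

lemma nn_frontier (ψ : Z → H) (ξ η : H) (z₁ z₂ : Z) (hne : z₁ ≠ z₂)
    (h1 : ∀ z, ⟪ψ z₁, ξ⟫ ≤ ⟪ψ z, ξ⟫) (h2 : ∀ z, ⟪ψ z₂, η⟫ ≤ ⟪ψ z, η⟫) :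
    dF ψ ξ ≤ ENNReal.ofReal ‖η - ξ‖ := by
  classical
  set p : ℝ → H := fun t => ξ + t • (η - ξ) with hp
  set A : Z → Set ℝ := fun z => {t | ∀ z', ⟪ψ z, p t⟫ ≤ ⟪ψ z', p t⟫} with hA
  have hpc : Continuous p := by fun_prop
  have hAc : ∀ z, IsClosed (A z) := by
    intro z
    simp only [hA, Set.ofPred_forall]
    exact isClosed_iInter fun z' => isClosed_le (by fun_prop) (by fun_prop)
  have hcov : ∀ t, ∃ z, t ∈ A z := by
    intro t
    obtain ⟨z, hz⟩ := Finite.exists_min fun z => ⟪ψ z, p t⟫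
    exact ⟨z, hz⟩
  have hcl2 : IsClosed (⋃ z : {z : Z // z ≠ z₁}, A z) := isClosed_iUnion_of_finite fun z => hAc _
  have hconn := isPreconnected_closed_iff.1 (isPreconnected_Icc (a := (0:ℝ)) (b := 1)) (A z₁)
    (⋃ z : {z : Z // z ≠ z₁}, A z) (hAc _) hcl2 (by
      intro t _
      obtain ⟨z, hz⟩ := hcov t
      by_cases hzz : z = z₁
      · left; rw [← hzz]; exact hz
      · right; exact Set.mem_iUnion.2 ⟨⟨z, hzz⟩, hz⟩)
    ⟨0, by simp, by simpa [hA, hp] using h1⟩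
    ⟨1, by simp, Set.mem_iUnion.2 ⟨⟨z₂, hne.symm⟩, by simpa [hA, hp] using h2⟩⟩
  obtain ⟨t, ht, ht1, ht2⟩ := hconn
  obtain ⟨⟨z, hz⟩, htz⟩ := Set.mem_iUnion.1 ht2
  have hmem : p t ∈ decisionFrontier ψ := ⟨z₁, z, hz.symm, ht1, htz⟩
  refine (Metric.infEDist_le_edist_of_mem hmem).trans ?_
  rw [edist_dist, dist_eq_norm]
  refine ENNReal.ofReal_le_ofReal ?_
  simp only [hp, sub_add_cancel_left, norm_neg, norm_smul, Real.norm_eq_abs, abs_of_nonneg ht.1]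
  exact mul_le_of_le_one_left (norm_nonneg _) ht.2

lemma nn_excess_le (ψ : Z → H) (cψ : ℝ) (hψ : ∀ z, ‖ψ z‖ ≤ cψ) (ξ η : H) (z₁ z₂ : Z)
    (h2 : ∀ z, ⟪ψ z₂, η⟫ ≤ ⟪ψ z, η⟫) :
    ⟪ψ z₂ - ψ z₁, ξ⟫ ≤ 2 * cψ * ‖η - ξ‖ := by
  have e : ⟪ψ z₂ - ψ z₁, ξ⟫ = (⟪ψ z₂, η⟫ - ⟪ψ z₁, η⟫) + ⟪ψ z₁, η - ξ⟫ - ⟪ψ z₂, η - ξ⟫ := by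
    simp only [inner_sub_left, inner_sub_right]; ring
  have a1 := h2 z₁
  have a2 := (abs_le.1 (abs_real_inner_le_norm (ψ z₁) (η - ξ))).2
  have a3 := (abs_le.1 (abs_real_inner_le_norm (ψ z₂) (η - ξ))).1
  have b1 := mul_le_mul_of_nonneg_right (hψ z₁) (norm_nonneg (η - ξ))
  have b2 := mul_le_mul_of_nonneg_right (hψ z₂) (norm_nonneg (η - ξ))
  rw [e]; linarith

lemma nn_msupp_ae (μ : Measure X) : ∀ᵐ x ∂μ, x ∈ msupp μ := by
  have : SecondCountableTopology X := UniformSpace.secondCountable_of_separable X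
  have : μ (msupp μ)ᶜ = 0 := by
    refine measure_null_of_locally_null _ fun x hx => ?_
    simp only [msupp, Set.mem_compl_iff, Set.mem_ofPred_eq, not_forall, not_lt,
      nonpos_iff_eq_zero] at hx
    obtain ⟨U, hU, hxU, h0⟩ := hx
    exact ⟨U, mem_nhdsWithin_of_mem_nhds (hU.mem_nhds hxU), h0⟩
  exact mem_ae_iff.2 this

lemma nn_exp_bound (A k₀ β : ℝ) (hA : 0 < A) (hk₀ : 0 < k₀) (hβ : 0 < β) (p : ℕ) :
    ∃ K : ℝ, 0 < K ∧ ∀ N s : ℝ, 1 ≤ N → 1 ≤ s →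
      min 1 (exp (k₀ * N - A * s ^ (1 / β) * N / 2)) ≤ K / s ^ p := by
  obtain ⟨m, hm⟩ := exists_nat_ge (β * p)
  set s0 := (4 * k₀ / A) ^ β with hs0
  have hs0p : 0 < s0 := by positivity
  refine ⟨m.factorial / (A / 4) ^ m + s0 ^ p, by positivity, fun N s hN hs => ?_⟩
  have hs' : 0 < s := by linarith
  have hsp : 0 < s ^ p := by positivity
  rw [le_div_iff₀ hsp]
  by_cases hcase : k₀ ≤ A * s ^ (1 / β) / 4
  · set y := A * s ^ (1 / β) / 4 with hy
    have hy0 : 0 < y := by positivity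
    have h1 : exp (k₀ * N - A * s ^ (1 / β) * N / 2) ≤ exp (-y) := by
      rw [exp_le_exp]
      have : A * s ^ (1 / β) * N / 2 = 2 * y * N := by rw [hy]; ring
      rw [this]
      nlinarith
    have h2 : exp (-y) ≤ m.factorial / y ^ m := by
      have := pow_div_factorial_le_exp y hy0.le m
      rw [exp_neg, inv_le_comm₀ (exp_pos _) (by positivity), inv_div]
      exact this
    have h3 : s ^ p ≤ (s ^ (1 / β)) ^ m := by
      rw [← rpow_natCast (s ^ (1 / β)), ← rpow_mul hs'.le, ← rpow_natCast s p]
      apply rpow_le_rpow_of_exponent_le hs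
      rw [div_mul_eq_mul_div, one_mul, le_div_iff₀ hβ]
      linarith
    have h4 : y ^ m = (A / 4) ^ m * (s ^ (1 / β)) ^ m := by rw [hy, ← mul_pow]; ring
    have h5 : min 1 (exp (k₀ * N - A * s ^ (1 / β) * N / 2)) ≤ m.factorial / y ^ m :=
      (min_le_right _ _).trans (h1.trans h2)
    calc _ ≤ m.factorial / y ^ m * (s ^ (1 / β)) ^ m :=
          mul_le_mul h5 h3 hsp.le (by positivity)
      _ = m.factorial / (A / 4) ^ m := by
          rw [h4]
          have : (s ^ (1 / β)) ^ m ≠ 0 := by positivity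
          field_simp
      _ ≤ _ := by have : 0 < s0 ^ p := by positivity
                  linarith
  · have h1 : s ≤ s0 := by
      have h2 : s ^ (1 / β) ≤ 4 * k₀ / A := by
        rw [le_div_iff₀ hA]; push Not at hcase; linarith
      have := rpow_le_rpow (by positivity) h2 hβ.le
      rwa [← rpow_mul hs'.le, one_div, inv_mul_cancel₀ hβ.ne', rpow_one] at this
    have h2 : s ^ p ≤ s0 ^ p := pow_le_pow_left₀ hs'.le h1 p
    have h3 : 0 < m.factorial / (A / 4) ^ m := by positivity
    calc _ ≤ 1 * s ^ p := mul_le_mul_of_nonneg_right (min_le_left _ _) hsp.le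
      _ ≤ _ := by linarith

lemma nn_bias_tail (μ : Measure X) [IsProbabilityMeasure μ] (g : X → H)
    (β cβ : ℝ) (hβ : 0 < β) (hcβ : 0 < cβ)
    (hlip : ∀ u ∈ msupp μ, ∀ v ∈ msupp μ,
      ‖g u - g v‖ ≤ cβ * (μ (Metric.closedBall u (dist u v))).toReal ^ β)
    (hcdf : ∀ x ∈ msupp μ, Continuous fun t : ℝ => (μ {u | dist x u ≤ t}).toReal)
    (x : X) (hx : x ∈ msupp μ) (n k : ℕ) (hk1 : 1 ≤ k) (hkn : k ≤ n) (u : ℝ) (hu : 0 < u) :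
    Measure.pi (fun _ : Fin n => μ)
      {v | cβ * u ^ β < ‖∑ i, nnWeight n k v x i • (g (v i) - g x)‖}
      ≤ ENNReal.ofReal (exp (k - n * u / 2)) := by
  have hdm : Measurable fun u => dist x u := (continuous_const.dist continuous_id).measurable
  have hSv : ∀ᵐ v ∂(Measure.pi fun _ : Fin n => μ), ∀ i, v i ∈ msupp μ := by
    rw [ae_all_iff]
    intro i
    exact (measurePreserving_eval (fun _ : Fin n => μ) i).quasiMeasurePreserving.ae (nn_msupp_ae μ)
  have hball : ∀ r, Metric.closedBall x r = {u | dist x u ≤ r} := by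
    intro r; ext y; simp [Metric.mem_closedBall, dist_comm]
  -- deterministic bound
  have hdet : ∀ v : Fin n → X, (∀ i, v i ∈ msupp μ) → (Function.Injective fun j => dist x (v j)) →
      ∀ c : ℝ, (∀ i, (Finset.univ.filter fun j => dist x (v j) < dist x (v i)).card < k →
        (μ {u | dist x u ≤ dist x (v i)}).toReal ^ β ≤ c) →
      ‖∑ i, nnWeight n k v x i • (g (v i) - g x)‖ ≤ cβ * c := by
    intro v hv hinj c hc
    calc _ ≤ ∑ i, ‖nnWeight n k v x i • (g (v i) - g x)‖ := norm_sum_le _ _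
      _ ≤ ∑ i, nnWeight n k v x i * (cβ * c) := by
        refine Finset.sum_le_sum fun i _ => ?_
        rw [nnWeight_inj n k v x hinj]
        split_ifs with h
        · rw [norm_smul, Real.norm_eq_abs, abs_of_nonneg (by positivity), norm_sub_rev]
          refine mul_le_mul_of_nonneg_left ?_ (by positivity)
          refine (hlip x hx (v i) (hv i)).trans ?_
          rw [hball]
          exact mul_le_mul_of_nonneg_left (hc i h) hcβ.le
        · simp
      _ = _ := by rw [← Finset.sum_mul, nnWeight_sum n k hk1 hkn v x hinj, one_mul]
  rcases le_or_gt 1 u with hu1 | hu1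
  · have : Measure.pi (fun _ : Fin n => μ)
      {v | cβ * u ^ β < ‖∑ i, nnWeight n k v x i • (g (v i) - g x)‖} = 0 := by
      rw [measure_eq_zero_iff_ae_notMem]
      filter_upwards [hSv, nn_ae_inj μ x (hcdf x hx) n] with v hv hinj
      simp only [not_lt]
      refine hdet v hv hinj _ fun i _ => ?_
      refine rpow_le_rpow ENNReal.toReal_nonneg ?_ hβ.le
      exact le_trans measureReal_le_one hu1
    rw [this]; exact zero_le
  · have hlim : Filter.Tendsto (fun m : ℕ => μ {y | dist x y ≤ m}) Filter.atTop (nhds 1) := by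
      have hmono : Monotone fun m : ℕ => {y | dist x y ≤ (m : ℝ)} := by
        intro a b hab y hy
        have hy' : dist x y ≤ a := hy
        have : (a : ℝ) ≤ b := by exact_mod_cast hab
        exact hy'.trans this
      have := tendsto_measure_iUnion_atTop (μ := μ) hmono
      have huniv : (⋃ m : ℕ, {y | dist x y ≤ (m : ℝ)}) = Set.univ := by
        ext y
        simp only [Set.mem_iUnion, Set.mem_univ, iff_true]
        exact exists_nat_ge (dist x y)
      rw [huniv, measure_univ] at this
      exact this
    have hlim2 := (ENNReal.tendsto_toReal ENNReal.one_ne_top).comp hlim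
    obtain ⟨m, hm⟩ := (hlim2.eventually (lt_mem_nhds (by simpa using hu1 : u < (1 : ℝ≥0∞).toReal))).exists
    obtain ⟨r, hr⟩ := mem_range_of_exists_le_of_exists_ge (hcdf x hx) (c := u)
      ⟨-1, by
        have : {y | dist x y ≤ (-1 : ℝ)} = ∅ := by
          ext y
          simp only [Set.mem_ofPred_eq, Set.mem_empty_iff_false, iff_false, not_le]
          have := dist_nonneg (x := x) (y := y)
          linarith
        simp only [this]
        simpa using hu.le⟩
      ⟨m, hm.le⟩
    simp only at hr
    have hch := nn_chernoff μ {y | dist x y ≤ r} (measurableSet_le hdm measurable_const) n k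
    have hr' : μ.real {y | dist x y ≤ r} = u := hr
    rw [hr'] at hch
    refine le_trans (measure_mono_ae ?_) hch
    filter_upwards [hSv, nn_ae_inj μ x (hcdf x hx) n] with v hv hinj hlt
    by_contra hcon
    have hcon' : k ≤ (Finset.univ.filter fun j => v j ∈ {y | dist x y ≤ r}).card := not_lt.1 hcon
    have hlt' : cβ * u ^ β < ‖∑ i, nnWeight n k v x i • (g (v i) - g x)‖ := hlt
    refine absurd hlt' (not_lt.2 (hdet v hv hinj _ fun i hi => ?_))
    refine rpow_le_rpow ENNReal.toReal_nonneg ?_ hβ.le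
    rw [← hr]
    refine ENNReal.toReal_mono (measure_ne_top _ _) (measure_mono ?_)
    intro y hy
    have hy' : dist x y ≤ dist x (v i) := hy
    refine hy'.trans ?_
    by_contra hgt
    push Not at hgt
    have : (Finset.univ.filter fun j => v j ∈ {y | dist x y ≤ r})
        ⊆ (Finset.univ.filter fun j => dist x (v j) < dist x (v i)) := by
      intro j hj
      simp only [Finset.mem_filter, Finset.mem_univ, true_and, Set.mem_ofPred_eq] at hj ⊢
      exact hj.trans_lt hgt
    have := Finset.card_le_card this
    omega

lemma nn_gStar_measurable (φ : Y → H) (hφ : Measurable φ) (κ : Kernel X Y) [IsMarkovKernel κ] :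
    Measurable (gStar φ κ) := by
  have : StronglyMeasurable fun x => ∫ y, φ y ∂(κ x) :=
    StronglyMeasurable.integral_kernel hφ.stronglyMeasurable
  exact this.measurable

lemma nn_memLp (φ : Y → H) (hφ : Measurable φ) (κ : Kernel X Y) [IsMarkovKernel κ] (x : X)
    (σ2 M : ℝ)
    (hmoment : ∀ m : ℕ, 2 ≤ m →
      ∫⁻ y, (‖φ y - gStar φ κ x‖₊ : ℝ≥0∞) ^ m ∂(κ x)
        ≤ ENNReal.ofReal ((1 / 2) * m.factorial * σ2 * M ^ (m - 2))) (m : ℕ) :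
    MemLp (fun y => φ y - gStar φ κ x) m (κ x) := by
  have h : MemLp (fun y => φ y - gStar φ κ x) ((m + 2 : ℕ) : ℝ≥0∞) (κ x) := by
    refine ⟨by fun_prop, ?_⟩
    rw [eLpNorm_lt_top_iff_lintegral_rpow_enorm_lt_top (by simp) (ENNReal.natCast_ne_top _)]
    have := (hmoment (m + 2) (by omega)).trans_lt ENNReal.ofReal_lt_top
    simpa only [ENNReal.toReal_natCast, ENNReal.rpow_natCast, enorm_eq_nnnorm] using this
  exact h.mono_exponent (by exact_mod_cast (by omega : m ≤ m + 2))

lemma nn_tail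
    (φ : Y → H) (hφ : Measurable φ)
    (μ : Measure X) [IsProbabilityMeasure μ] (κ : Kernel X Y) [IsMarkovKernel κ]
    (σ2 M : ℝ) (hσ2 : 0 < σ2) (hM : 0 < M)
    (hmoment : ∀ x ∈ msupp μ, ∀ m : ℕ, 2 ≤ m →
      ∫⁻ y, (‖φ y - gStar φ κ x‖₊ : ℝ≥0∞) ^ m ∂(κ x)
        ≤ ENNReal.ofReal ((1 / 2) * m.factorial * σ2 * M ^ (m - 2)))
    (β cβ : ℝ) (hβ : 0 < β) (hcβ : 0 < cβ)
    (hlip : ∀ u ∈ msupp μ, ∀ v ∈ msupp μ,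
      ‖gStar φ κ u - gStar φ κ v‖ ≤ cβ * (μ (Metric.closedBall u (dist u v))).toReal ^ β)
    (hcdf : ∀ x ∈ msupp μ, Continuous fun t : ℝ => (μ {u | dist x u ≤ t}).toReal)
    (k₀ : ℝ) (hk₀ : 0 < k₀) (p : ℕ) :
    ∃ K : ℝ, 0 < K ∧ ∃ n₀ : ℕ, ∀ n : ℕ, n₀ ≤ n → ∀ x ∈ msupp μ, ∀ s : ℝ, 1 ≤ s →
      Measure.pi (fun _ : Fin n => μ ⊗ₘ κ)
        {D | s * (n : ℝ) ^ (-β / (2 * β + 1)) ≤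
          ‖gNN φ n ⌊k₀ * (n : ℝ) ^ (2 * β / (2 * β + 1))⌋₊ D x - gStar φ κ x‖}
        ≤ ENNReal.ofReal (K / s ^ p) := by
  have hgm := nn_gStar_measurable φ hφ κ
  have hLp := fun x hx m => nn_memLp φ hφ κ x σ2 M (hmoment x hx) m
  obtain ⟨K1, hK1, hnoise⟩ := nn_noise_tail μ κ φ hφ (gStar φ κ) hgm (msupp μ) (nn_msupp_ae μ)
    (fun m => (1 / 2) * (2 * m).factorial * σ2 * M ^ (2 * m - 2)) (fun m => by positivity)
    (by
      intro x hx
      have h1 : Integrable (fun y => φ y - gStar φ κ x) (κ x) := (hLp x hx 1).integrable (by simp)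
      have h2 : Integrable φ (κ x) := by
        have := h1.add (integrable_const (gStar φ κ x))
        refine this.congr (Filter.Eventually.of_forall fun y => ?_)
        simp
      rw [integral_sub h2 (integrable_const _)]
      simp [gStar])
    hLp
    (by
      intro x hx m hm
      rw [integral_eq_lintegral_of_nonneg_ae (Filter.Eventually.of_forall fun y => by positivity)
        (by fun_prop)]
      refine ENNReal.toReal_le_of_le_ofReal (by positivity) ?_
      refine le_trans (le_of_eq ?_) (hmoment x hx (2 * m) (by omega))
      refine lintegral_congr fun y => ?_
      rw [ENNReal.ofReal_pow (norm_nonneg _), ofReal_norm, enorm_eq_nnnorm]) p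
  set A : ℝ := (1 / (4 * cβ)) ^ (1 / β) with hA
  have hA0 : 0 < A := by positivity
  obtain ⟨K2, hK2, hexp⟩ := nn_exp_bound A k₀ β hA0 hk₀ hβ p
  have h2β : 0 < 2 * β + 1 := by positivity
  have ht1 : Filter.Tendsto (fun n : ℕ => (n : ℝ) ^ (2 * β / (2 * β + 1))) Filter.atTop
      Filter.atTop := (tendsto_rpow_atTop (by positivity)).comp tendsto_natCast_atTop_atTop
  have ht2 : Filter.Tendsto (fun n : ℕ => (n : ℝ) ^ (1 / (2 * β + 1))) Filter.atTop
      Filter.atTop := (tendsto_rpow_atTop (by positivity)).comp tendsto_natCast_atTop_atTop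
  obtain ⟨n₀, hn₀⟩ := Filter.eventually_atTop.1 ((ht1.eventually_ge_atTop (1 / k₀)).and
    ((ht2.eventually_ge_atTop k₀).and (Filter.eventually_ge_atTop 1)))
  refine ⟨K1 * (8 / k₀) ^ p + K2, by positivity, n₀, fun n hn x hx s hs => ?_⟩
  obtain ⟨hn1, hn2, hn3⟩ := hn₀ n hn
  set N : ℝ := (n : ℝ) ^ (2 * β / (2 * β + 1)) with hN
  set δ : ℝ := (n : ℝ) ^ (-β / (2 * β + 1)) with hδ
  set k : ℕ := ⌊k₀ * N⌋₊ with hk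
  have hnR : (1 : ℝ) ≤ n := by exact_mod_cast hn3
  have hn0 : (0 : ℝ) < n := by linarith
  have hδ0 : 0 < δ := rpow_pos_of_pos hn0 _
  have hN1 : 1 ≤ N := one_le_rpow hnR (by positivity)
  have hkN : 1 ≤ k₀ * N := by
    rw [div_le_iff₀ hk₀] at hn1; linarith
  have hk1 : 1 ≤ k := Nat.one_le_floor_iff _ |>.2 hkN
  have hkR : (k : ℝ) ≤ k₀ * N := Nat.floor_le (by positivity)
  have hkL : k₀ * N / 2 ≤ k := by
    have := Nat.lt_floor_add_one (k₀ * N)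
    have h1 : (1 : ℝ) ≤ k := by exact_mod_cast hk1
    rw [← hk] at this
    linarith
  have hNn : N * (n : ℝ) ^ (1 / (2 * β + 1)) = n := by
    rw [hN, ← rpow_add hn0]
    conv_rhs => rw [← rpow_one (n : ℝ)]
    congr 1
    field_simp
  have hkn : k ≤ n := by
    have : (k : ℝ) ≤ n := by
      refine hkR.trans ?_
      rw [← hNn, mul_comm]
      exact mul_le_mul_of_nonneg_left hn2 (by positivity)
    exact_mod_cast this
  have hδN : δ ^ 2 * N = 1 := by
    rw [hδ, hN, ← rpow_natCast, ← rpow_mul hn0.le, ← rpow_add hn0]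
    rw [show -β / (2 * β + 1) * ((2 : ℕ) : ℝ) + 2 * β / (2 * β + 1) = 0 by push_cast; ring]
    exact rpow_zero _
  have hs0 : 0 < s := by linarith
  set u : ℝ := A * s ^ (1 / β) * (n : ℝ) ^ (-(1 / (2 * β + 1))) with hu
  have hu0 : 0 < u := by positivity
  have huβ : cβ * u ^ β = s * δ / 4 := by
    rw [hu, mul_rpow (by positivity) (by positivity), mul_rpow (by positivity) (by positivity), hA,
      ← rpow_mul (by positivity), ← rpow_mul hs0.le, ← rpow_mul hn0.le, one_div β,
      inv_mul_cancel₀ hβ.ne', rpow_one, rpow_one, hδ]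
    rw [show -(1 / (2 * β + 1)) * β = -β / (2 * β + 1) by ring]
    field_simp
  have hnu : n * u = A * s ^ (1 / β) * N := by
    rw [hu, hN]
    rw [show (2 * β / (2 * β + 1)) = 1 + -(1 / (2 * β + 1)) by field_simp; ring,
      rpow_add hn0, rpow_one]
    ring
  -- the projection to the inputs
  have hmp : MeasurePreserving (fun (D : Fin n → X × Y) (j : Fin n) => (D j).1)
      (Measure.pi fun _ : Fin n => μ ⊗ₘ κ) (Measure.pi fun _ : Fin n => μ) := by
    refine ⟨by fun_prop, ?_⟩
    rw [Measure.pi_map_pi (f := fun _ => Prod.fst) (fun i => by fun_prop)]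
    congr 1
    funext i
    exact Measure.fst_compProd μ κ
  have hinj := nn_ae_inj μ x (hcdf x hx) n
  have hinjD := hmp.quasiMeasurePreserving.ae hinj
  have hA1 := hnoise n (fun v i => nnWeight n k v x i) (fun i => nnWeight_measurable n k x i) (1 / k)
    (by filter_upwards [hinj] with v hv using (nnWeight_sum_sq n k hk1 hkn v x hv).le)
    (s * δ / 2) (by positivity)
  have hA2 := nn_bias_tail μ (gStar φ κ) β cβ hβ hcβ hlip hcdf x hx n k hk1 hkn u hu0
  rw [huβ] at hA2
  set E2 : Set (Fin n → X) :=
    {v | s * δ / 4 < ‖∑ i, nnWeight n k v x i • (gStar φ κ (v i) - gStar φ κ x)‖} with hE2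
  have hA2' : Measure.pi (fun _ : Fin n => μ ⊗ₘ κ)
      ((fun (D : Fin n → X × Y) (j : Fin n) => (D j).1) ⁻¹' E2) ≤ ENNReal.ofReal (K2 / s ^ p) := by
    have h1 : Measure.pi (fun _ : Fin n => μ ⊗ₘ κ)
      ((fun (D : Fin n → X × Y) (j : Fin n) => (D j).1) ⁻¹' E2) ≤ Measure.pi (fun _ => μ) E2 := by
      rw [← hmp.map_eq]
      exact Measure.le_map_apply hmp.measurable.aemeasurable _
    refine h1.trans ?_
    have h2 : Measure.pi (fun _ : Fin n => μ) E2
        ≤ ENNReal.ofReal (min 1 (exp (k₀ * N - A * s ^ (1 / β) * N / 2))) := by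
      rw [ENNReal.ofReal_min]
      refine le_min (by simpa using prob_le_one) (hA2.trans (ENNReal.ofReal_le_ofReal ?_))
      rw [exp_le_exp, hnu]
      linarith
    exact h2.trans (ENNReal.ofReal_le_ofReal (hexp N s hN1 hs))
  have hA1' : K1 * (1 / (k : ℝ)) ^ p / (s * δ / 2) ^ (2 * p) ≤ K1 * (8 / k₀) ^ p / s ^ p := by
    have hk0 : (0:ℝ) < k := by exact_mod_cast hk1
    have h1 : k₀ / 2 ≤ k * δ ^ 2 := by
      have := mul_le_mul_of_nonneg_right hkL (sq_nonneg δ)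
      calc k₀ / 2 = k₀ * N / 2 * δ ^ 2 := by
            rw [show k₀ * N / 2 * δ ^ 2 = k₀ / 2 * (δ ^ 2 * N) by ring, hδN, mul_one]
        _ ≤ _ := this
    have h2 : K1 * (1 / (k : ℝ)) ^ p / (s * δ / 2) ^ (2 * p)
        = K1 * (4 / (k * δ ^ 2)) ^ p / (s ^ p * s ^ p) := by
      have e : 1 / (k : ℝ) / (s * δ / 2) ^ 2 = 4 / (k * δ ^ 2) / (s * s) := by
        field_simp
        norm_num
      rw [pow_mul, ← mul_pow s s, mul_div_assoc, ← div_pow, e, div_pow _ (s * s), ← mul_div_assoc]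
    rw [h2]
    have h3 : 4 / (k * δ ^ 2) ≤ 8 / k₀ := by
      rw [div_le_div_iff₀ (by positivity) hk₀]; linarith
    have h4 : 1 ≤ s ^ p := one_le_pow₀ hs
    gcongr
    nlinarith
  set E1 : Set (Fin n → X × Y) := {D | s * δ / 2 ≤ ‖∑ i, nnWeight n k (fun j => (D j).1) x i •
          (φ (D i).2 - gStar φ κ (D i).1)‖} with hE1
  calc _ ≤ Measure.pi (fun _ : Fin n => μ ⊗ₘ κ)
        (E1 ∪ ((fun (D : Fin n → X × Y) (j : Fin n) => (D j).1) ⁻¹' E2)) := by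
        refine measure_mono_ae ?_
        filter_upwards [hinjD] with D hD hbig
        by_contra hcon
        have hcon' : D ∉ (E1 ∪ ((fun (D : Fin n → X × Y) (j : Fin n) => (D j).1) ⁻¹' E2)) := hcon
        rw [Set.mem_union, not_or] at hcon'
        have c1 : ‖∑ i, nnWeight n k (fun j => (D j).1) x i •
          (φ (D i).2 - gStar φ κ (D i).1)‖ < s * δ / 2 := not_le.1 hcon'.1
        have c2 : ‖∑ i, nnWeight n k (fun j => (D j).1) x i •
          (gStar φ κ (D i).1 - gStar φ κ x)‖ ≤ s * δ / 4 := not_lt.1 hcon'.2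
        have hbig' : s * δ ≤ ‖gNN φ n k D x - gStar φ κ x‖ := hbig
        have hdec : gNN φ n k D x - gStar φ κ x
            = ∑ i, nnWeight n k (fun j => (D j).1) x i • (φ (D i).2 - gStar φ κ (D i).1)
            + ∑ i, nnWeight n k (fun j => (D j).1) x i • (gStar φ κ (D i).1 - gStar φ κ x) := by
          rw [← Finset.sum_add_distrib]
          simp only [← smul_add, sub_add_sub_cancel]
          simp only [smul_sub, Finset.sum_sub_distrib]
          rw [← Finset.sum_smul, nnWeight_sum n k hk1 hkn _ x hD, one_smul]
          rfl
        have := norm_add_le (∑ i, nnWeight n k (fun j => (D j).1) x i •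
          (φ (D i).2 - gStar φ κ (D i).1)) (∑ i, nnWeight n k (fun j => (D j).1) x i •
          (gStar φ κ (D i).1 - gStar φ κ x))
        rw [← hdec] at this
        have : 0 < s * δ := by positivity
        linarith
    _ ≤ _ := measure_union_le _ _
    _ ≤ ENNReal.ofReal (K1 * (8 / k₀) ^ p / s ^ p) + ENNReal.ofReal (K2 / s ^ p) :=
        add_le_add (hA1.trans (ENNReal.ofReal_le_ofReal hA1')) hA2'
    _ = _ := by
        rw [← ENNReal.ofReal_add (by positivity) (by positivity), add_div]

set_option linter.unusedSectionVars false

lemma nn_risk_eq (ψ : Z → H) (φ : Y → H) (hφ : Measurable φ)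
    (μ : Measure X) [IsProbabilityMeasure μ] (κ : Kernel X Y) [IsMarkovKernel κ]
    (hφ1 : Integrable (fun p : X × Y => φ p.2) (μ ⊗ₘ κ)) (cψ : ℝ) (hψ : ∀ z, ‖ψ z‖ ≤ cψ)
    (f : X → Z) (hf : Measurable f) :
    risk ψ φ (μ ⊗ₘ κ) f = ∫ x, ⟪ψ (f x), gStar φ κ x⟫ ∂μ := by
  have hψm : Measurable ψ := measurable_of_finite ψ
  have hint : Integrable (fun p : X × Y => ⟪ψ (f p.1), φ p.2⟫) (μ ⊗ₘ κ) := by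
    refine (hφ1.norm.const_mul cψ).mono' ?_ (Filter.Eventually.of_forall fun p => ?_)
    · exact Measurable.aestronglyMeasurable (by fun_prop)
    · exact (norm_inner_le_norm _ _).trans (mul_le_mul_of_nonneg_right (hψ _) (norm_nonneg _))
  rw [risk, Measure.integral_compProd hint]
  refine integral_congr_ae ?_
  have h := (Measure.integrable_compProd_iff hφ1.aestronglyMeasurable).1 hφ1
  filter_upwards [h.1] with x hx
  exact integral_inner hx _

lemma nn_gStar_integrable (φ : Y → H) (hφ : Measurable φ)
    (μ : Measure X) [IsProbabilityMeasure μ] (κ : Kernel X Y) [IsMarkovKernel κ]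
    (hφ1 : Integrable (fun p : X × Y => φ p.2) (μ ⊗ₘ κ)) : Integrable (gStar φ κ) μ := by
  have h := (Measure.integrable_compProd_iff hφ1.aestronglyMeasurable).1 hφ1
  exact h.2.mono' (nn_gStar_measurable φ hφ κ).aestronglyMeasurable
    (Filter.Eventually.of_forall fun x => norm_integral_le_integral_norm _)

lemma nn_lhs_eq (ψ : Z → H) (φ : Y → H) (hφ : Measurable φ)
    (μ : Measure X) [IsProbabilityMeasure μ] (κ : Kernel X Y) [IsMarkovKernel κ]
    (hφ1 : Integrable (fun p : X × Y => φ p.2) (μ ⊗ₘ κ)) (cψ : ℝ) (hψ : ∀ z, ‖ψ z‖ ≤ cψ)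
    (fstar : X → Z) (hfstar : IsDecoding ψ (gStar φ κ) fstar) (n : ℕ)
    (fn : (Fin n → X × Y) → X → Z) (hfn : Measurable (Function.uncurry fn)) :
    ENNReal.ofReal ((∫ D, risk ψ φ (μ ⊗ₘ κ) (fn D) ∂(Measure.pi fun _ : Fin n => μ ⊗ₘ κ))
            - risk ψ φ (μ ⊗ₘ κ) fstar) =
      ∫⁻ x, ∫⁻ D, ENNReal.ofReal ⟪ψ (fn D x) - ψ (fstar x), gStar φ κ x⟫
        ∂(Measure.pi fun _ : Fin n => μ ⊗ₘ κ) ∂μ := by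
  have hψm : Measurable ψ := measurable_of_finite ψ
  have hgm := nn_gStar_measurable φ hφ κ
  have hg := nn_gStar_integrable φ hφ μ κ hφ1
  have hfs := hfstar.1
  set P := (Measure.pi fun _ : Fin n => μ ⊗ₘ κ) with hP
  have hfnD : ∀ D, Measurable (fn D) := fun D => hfn.comp (measurable_const.prodMk measurable_id)
  have hm1 : Measurable (fun q : (Fin n → X × Y) × X => ψ (fn q.1 q.2)) := hψm.comp hfn
  have hgP : Integrable (fun q : (Fin n → X × Y) × X => gStar φ κ q.2) (P.prod μ) := hg.comp_snd P
  have hF1 : Integrable (fun q : (Fin n → X × Y) × X => ⟪ψ (fn q.1 q.2), gStar φ κ q.2⟫)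
      (P.prod μ) := by
    refine (hgP.norm.const_mul cψ).mono' ?_ (Filter.Eventually.of_forall fun p => ?_)
    · exact Measurable.aestronglyMeasurable (by fun_prop)
    · exact (norm_inner_le_norm _ _).trans (mul_le_mul_of_nonneg_right (hψ _) (norm_nonneg _))
  have hF2 : Integrable (fun q : (Fin n → X × Y) × X => ⟪ψ (fstar q.2), gStar φ κ q.2⟫)
      (P.prod μ) := by
    refine (hgP.norm.const_mul cψ).mono' ?_ (Filter.Eventually.of_forall fun p => ?_)
    · exact Measurable.aestronglyMeasurable (by fun_prop)
    · exact (norm_inner_le_norm _ _).trans (mul_le_mul_of_nonneg_right (hψ _) (norm_nonneg _))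
  have e1 : ∫ D, risk ψ φ (μ ⊗ₘ κ) (fn D) ∂P
      = ∫ q, ⟪ψ (fn q.1 q.2), gStar φ κ q.2⟫ ∂(P.prod μ) := by
    rw [integral_prod _ hF1]
    exact integral_congr_ae (Filter.Eventually.of_forall fun D =>
      nn_risk_eq ψ φ hφ μ κ hφ1 cψ hψ (fn D) (hfnD D))
  have e2 : risk ψ φ (μ ⊗ₘ κ) fstar
      = ∫ q, ⟪ψ (fstar q.2), gStar φ κ q.2⟫ ∂(P.prod μ) := by
    rw [integral_prod _ hF2, nn_risk_eq ψ φ hφ μ κ hφ1 cψ hψ fstar hfs]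
    simp
  rw [e1, e2, ← integral_sub hF1 hF2]
  simp only [← inner_sub_left]
  rw [ofReal_integral_eq_lintegral_ofReal]
  · rw [lintegral_prod_symm _ (Measurable.aemeasurable (by fun_prop))]
  · refine (hF1.sub hF2).congr (Filter.Eventually.of_forall fun q => ?_)
    simp only [Pi.sub_apply, inner_sub_left]
  · refine Filter.Eventually.of_forall fun q => ?_
    simp only [Pi.zero_apply, inner_sub_left]
    linarith [hfstar.2 q.2 (fn q.1 q.2)]

lemma nn_gNN_measurable (φ : Y → H) (hφ : Measurable φ) (n k : ℕ) (x : X) :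
    Measurable fun D : Fin n → X × Y => gNN φ n k D x := by
  unfold gNN
  refine Finset.measurable_sum _ fun i _ => ?_
  refine Measurable.smul ((nnWeight_measurable n k x i).comp (by fun_prop)) (by fun_prop)

lemma nn_dyadic (h δ : ℝ) (hδ : 0 < δ) :
    ∃ j : ℕ, h < 2 ^ j * δ ∧ (j = 0 ∨ 2 ^ (j - 1) * δ ≤ h) := by
  classical
  have hex : ∃ j : ℕ, h < 2 ^ j * δ := by
    obtain ⟨j, hj⟩ := pow_unbounded_of_one_lt (h / δ) (one_lt_two)
    exact ⟨j, (div_lt_iff₀ hδ).1 hj⟩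
  refine ⟨Nat.find hex, Nat.find_spec hex, ?_⟩
  by_cases h0 : Nat.find hex = 0
  · exact Or.inl h0
  · exact Or.inr (not_lt.1 (Nat.find_min hex (Nat.sub_lt (Nat.pos_of_ne_zero h0) one_pos)))

lemma nn_pointwise (ψ : Z → H) (cψ : ℝ) (hψ : ∀ z, ‖ψ z‖ ≤ cψ) (ξ η : H) (z₁ z₂ : Z)
    (h1 : ∀ z, ⟪ψ z₁, ξ⟫ ≤ ⟪ψ z, ξ⟫) (h2 : ∀ z, ⟪ψ z₂, η⟫ ≤ ⟪ψ z, η⟫) (δ : ℝ) (hδ : 0 < δ) :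
    ∃ j : ℕ, ENNReal.ofReal ⟪ψ z₂ - ψ z₁, ξ⟫ ≤ ENNReal.ofReal (2 * cψ * (2 ^ j * δ)) *
      (({ξ | dF ψ ξ < ENNReal.ofReal (2 ^ j * δ)} : Set H).indicator 1 ξ *
      ({η | j = 0 ∨ 2 ^ (j - 1) * δ ≤ ‖η - ξ‖} : Set H).indicator 1 η) := by
  obtain ⟨j, hj1, hj2⟩ := nn_dyadic ‖η - ξ‖ δ hδ
  refine ⟨j, ?_⟩
  by_cases hz : z₁ = z₂
  · subst hz; simp
  have hF := nn_frontier ψ ξ η z₁ z₂ hz h1 h2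
  have hE := nn_excess_le ψ cψ hψ ξ η z₁ z₂ h2
  have hc : 0 ≤ cψ := (norm_nonneg _).trans (hψ z₁)
  have m1 : ξ ∈ ({ξ | dF ψ ξ < ENNReal.ofReal (2 ^ j * δ)} : Set H) :=
    hF.trans_lt ((ENNReal.ofReal_lt_ofReal_iff (by positivity)).2 hj1)
  have m2 : η ∈ ({η | j = 0 ∨ 2 ^ (j - 1) * δ ≤ ‖η - ξ‖} : Set H) := hj2
  rw [Set.indicator_of_mem m1, Set.indicator_of_mem m2]
  simp only [Pi.one_apply, mul_one]
  refine ENNReal.ofReal_le_ofReal (hE.trans ?_)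
  exact mul_le_mul_of_nonneg_left hj1.le (by positivity)

lemma nn_inner_bound (ψ : Z → H) (φ : Y → H) (cψ : ℝ) (hψ : ∀ z, ‖ψ z‖ ≤ cψ) (hφ : Measurable φ)
    (n k p : ℕ) (P : Measure (Fin n → X × Y)) [IsProbabilityMeasure P] (x : X) (ξ : H) (z₁ : Z)
    (h1 : ∀ z, ⟪ψ z₁, ξ⟫ ≤ ⟪ψ z, ξ⟫) (fnx : (Fin n → X × Y) → Z)
    (h2 : ∀ D z, ⟪ψ (fnx D), gNN φ n k D x⟫ ≤ ⟪ψ z, gNN φ n k D x⟫)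
    (δ K : ℝ) (hδ : 0 < δ) (hK : 0 < K)
    (htail : ∀ s : ℝ, 1 ≤ s → P {D | s * δ ≤ ‖gNN φ n k D x - ξ‖} ≤ ENNReal.ofReal (K / s ^ p)) :
    ∫⁻ D, ENNReal.ofReal ⟪ψ (fnx D) - ψ z₁, ξ⟫ ∂P ≤
      ∑' j : ℕ, ENNReal.ofReal (2 * cψ * (2 ^ j * δ)) *
      (({ξ | dF ψ ξ < ENNReal.ofReal (2 ^ j * δ)} : Set H).indicator 1 ξ *
        ENNReal.ofReal ((K + 1) * 2 ^ p / (2 ^ j) ^ p)) := by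
  have hgm := nn_gNN_measurable φ hφ n k x
  have hS : ∀ j : ℕ, MeasurableSet ({η | j = 0 ∨ 2 ^ (j - 1) * δ ≤ ‖η - ξ‖} : Set H) := by
    intro j
    refine (MeasurableSet.const (j = 0)).union
      (measurableSet_le (f := fun _ : H => 2 ^ (j - 1) * δ) (g := fun η : H => ‖η - ξ‖)
        (by fun_prop) (by fun_prop))
  calc _ ≤ ∫⁻ D, ∑' j : ℕ, ENNReal.ofReal (2 * cψ * (2 ^ j * δ)) *
      (({ξ | dF ψ ξ < ENNReal.ofReal (2 ^ j * δ)} : Set H).indicator 1 ξ *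
      ({η | j = 0 ∨ 2 ^ (j - 1) * δ ≤ ‖η - ξ‖} : Set H).indicator 1 (gNN φ n k D x)) ∂P := by
        refine lintegral_mono fun D => ?_
        obtain ⟨j, hj⟩ := nn_pointwise ψ cψ hψ ξ (gNN φ n k D x) z₁ (fnx D) h1 (h2 D) δ hδ
        exact hj.trans (ENNReal.le_tsum (f := fun j : ℕ => ENNReal.ofReal (2 * cψ * (2 ^ j * δ)) *
          (({ξ | dF ψ ξ < ENNReal.ofReal (2 ^ j * δ)} : Set H).indicator 1 ξ *
          ({η | j = 0 ∨ 2 ^ (j - 1) * δ ≤ ‖η - ξ‖} : Set H).indicator 1 (gNN φ n k D x))) j)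
    _ = ∑' j : ℕ, ∫⁻ D, ENNReal.ofReal (2 * cψ * (2 ^ j * δ)) *
      (({ξ | dF ψ ξ < ENNReal.ofReal (2 ^ j * δ)} : Set H).indicator 1 ξ *
      ({η | j = 0 ∨ 2 ^ (j - 1) * δ ≤ ‖η - ξ‖} : Set H).indicator 1 (gNN φ n k D x)) ∂P := by
        refine lintegral_tsum fun j => ?_
        refine Measurable.aemeasurable (Measurable.const_mul (Measurable.const_mul ?_ _) _)
        exact (measurable_one.indicator (hS j)).comp hgm
    _ ≤ _ := by
        refine ENNReal.tsum_le_tsum fun j => ?_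
        have hmj : Measurable fun D : Fin n → X × Y =>
          ({η | j = 0 ∨ 2 ^ (j - 1) * δ ≤ ‖η - ξ‖} : Set H).indicator (1 : H → ℝ≥0∞)
            (gNN φ n k D x) := (measurable_one.indicator (hS j)).comp hgm
        rw [lintegral_const_mul _ (hmj.const_mul _), lintegral_const_mul _ hmj]
        gcongr
        have e : ∀ D : Fin n → X × Y,
          ({η | j = 0 ∨ 2 ^ (j - 1) * δ ≤ ‖η - ξ‖} : Set H).indicator (1 : H → ℝ≥0∞)
            (gNN φ n k D x) = ({D | j = 0 ∨ 2 ^ (j - 1) * δ ≤ ‖gNN φ n k D x - ξ‖} :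
              Set (Fin n → X × Y)).indicator 1 D := by
          intro D; rfl
        simp_rw [e]
        have hSD : MeasurableSet ({D | j = 0 ∨ 2 ^ (j - 1) * δ ≤ ‖gNN φ n k D x - ξ‖} :
              Set (Fin n → X × Y)) := hgm (hS j)
        rw [lintegral_indicator_one hSD]
        rcases Nat.eq_zero_or_pos j with rfl | hj
        · refine prob_le_one.trans ?_
          rw [← ENNReal.ofReal_one]
          refine ENNReal.ofReal_le_ofReal ?_
          have : (1 : ℝ) ≤ 2 ^ p := one_le_pow₀ one_le_two
          simp only [pow_zero, one_pow, div_one]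
          nlinarith
        · obtain ⟨i, rfl⟩ : ∃ i, j = i + 1 := ⟨j - 1, by omega⟩
          have hset : ({D | i + 1 = 0 ∨ 2 ^ (i + 1 - 1) * δ ≤ ‖gNN φ n k D x - ξ‖} :
              Set (Fin n → X × Y)) = {D | 2 ^ i * δ ≤ ‖gNN φ n k D x - ξ‖} := by
            ext D; simp
          rw [hset]
          refine (htail (2 ^ i) (one_le_pow₀ one_le_two)).trans (ENNReal.ofReal_le_ofReal ?_)
          rw [pow_succ, mul_pow, mul_div_mul_right _ _ (by positivity)]
          gcongr
          linarith


lemma nn_outer (ψ : Z → H) (cψ : ℝ) (hc : 0 ≤ cψ) (μ : Measure X) [IsProbabilityMeasure μ]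
    (g : X → H) (hg : Measurable g) (α cα : ℝ) (hα : 0 < α) (hcα : 0 < cα)
    (hlow : ∀ t : ℝ, 0 < t → μ {x | dF ψ (g x) < ENNReal.ofReal t} ≤ ENNReal.ofReal (cα * t ^ α))
    (p : ℕ) (hp : α + 2 ≤ p) (δ K' : ℝ) (hδ : 0 < δ) (hK' : 0 < K') :
    ∫⁻ x, ∑' j : ℕ, ENNReal.ofReal (2 * cψ * (2 ^ j * δ)) *
      (({ξ | dF ψ ξ < ENNReal.ofReal (2 ^ j * δ)} : Set H).indicator 1 (g x) *
        ENNReal.ofReal (K' / (2 ^ j) ^ p)) ∂μ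
      ≤ ENNReal.ofReal (2 * cψ * K' * cα * δ ^ (α + 1) * 2) := by
  have hS : ∀ j : ℕ, MeasurableSet ({ξ | dF ψ ξ < ENNReal.ofReal (2 ^ j * δ)} : Set H) := by
    intro j
    refine measurableSet_lt (f := fun ξ => dF ψ ξ) ?_ measurable_const
    exact (Metric.continuous_infEDist).measurable
  have hm : ∀ j : ℕ, Measurable fun x =>
      ({ξ | dF ψ ξ < ENNReal.ofReal (2 ^ j * δ)} : Set H).indicator (1 : H → ℝ≥0∞) (g x) :=
    fun j => (measurable_one.indicator (hS j)).comp hg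
  rw [lintegral_tsum fun j => (((hm j).mul_const _).const_mul _).aemeasurable]
  have hsum : ∑' j : ℕ, ENNReal.ofReal (2 * cψ * K' * cα * δ ^ (α + 1) * (1 / 2) ^ j)
      = ENNReal.ofReal (2 * cψ * K' * cα * δ ^ (α + 1) * 2) := by
    rw [← ENNReal.ofReal_tsum_of_nonneg (fun j => by positivity)
      (summable_geometric_two.mul_left _), tsum_mul_left, tsum_geometric_two]
  rw [← hsum]
  refine ENNReal.tsum_le_tsum fun j => ?_
  rw [lintegral_const_mul _ ((hm j).mul_const _), lintegral_mul_const _ (hm j)]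
  have e : ∫⁻ x, ({ξ | dF ψ ξ < ENNReal.ofReal (2 ^ j * δ)} : Set H).indicator (1 : H → ℝ≥0∞) (g x) ∂μ
      = μ {x | dF ψ (g x) < ENNReal.ofReal (2 ^ j * δ)} := by
    have hSx : MeasurableSet {x | dF ψ (g x) < ENNReal.ofReal (2 ^ j * δ)} := hg (hS j)
    rw [← lintegral_indicator_one hSx]
    rfl
  rw [e]
  have hj : (0:ℝ) < 2 ^ j * δ := by positivity
  calc _ ≤ ENNReal.ofReal (2 * cψ * (2 ^ j * δ)) * (ENNReal.ofReal (cα * (2 ^ j * δ) ^ α) *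
        ENNReal.ofReal (K' / (2 ^ j) ^ p)) := by gcongr; exact hlow _ hj
    _ = ENNReal.ofReal (2 * cψ * (2 ^ j * δ) * (cα * (2 ^ j * δ) ^ α * (K' / (2 ^ j) ^ p))) := by
        rw [← ENNReal.ofReal_mul (by positivity), ← ENNReal.ofReal_mul (by positivity)]
    _ ≤ _ := by
        refine ENNReal.ofReal_le_ofReal ?_
        have h2 : (0:ℝ) < 2 ^ j := by positivity
        have h21 : (1:ℝ) ≤ 2 ^ j := one_le_pow₀ one_le_two
        have key : (2:ℝ) ^ j * ((2:ℝ) ^ j) ^ α / ((2:ℝ) ^ j) ^ p ≤ (1 / 2) ^ j := by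
          rw [one_div, inv_pow, div_le_iff₀ (by positivity), ← div_eq_inv_mul, le_div_iff₀ h2]
          calc (2:ℝ) ^ j * ((2:ℝ) ^ j) ^ α * 2 ^ j = ((2:ℝ) ^ j) ^ (α + 2) := by
                rw [rpow_add h2, rpow_two]; ring
            _ ≤ ((2:ℝ) ^ j) ^ (p : ℝ) := rpow_le_rpow_of_exponent_le h21 hp
            _ = _ := rpow_natCast _ _
        calc _ = 2 * cψ * K' * cα * δ ^ (α + 1) *
              ((2:ℝ) ^ j * ((2:ℝ) ^ j) ^ α / ((2:ℝ) ^ j) ^ p) := by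
              rw [mul_rpow h2.le hδ.le, rpow_add hδ, rpow_one]; ring
          _ ≤ _ := by gcongr

lemma nn_trivial_bound (ψ : Z → H) (cψ : ℝ) (hc : 0 ≤ cψ) (hψ : ∀ z, ‖ψ z‖ ≤ cψ) (μ : Measure X)
    (g : X → H) (hg : Integrable g μ) {Ω : Type*} [MeasurableSpace Ω] (P : Measure Ω)
    [IsProbabilityMeasure P] (fn : Ω → X → Z) (fstar : X → Z) :
    ∫⁻ x, ∫⁻ D, ENNReal.ofReal ⟪ψ (fn D x) - ψ (fstar x), g x⟫ ∂P ∂μ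
      ≤ ENNReal.ofReal (∫ x, 2 * cψ * ‖g x‖ ∂μ) := by
  rw [ofReal_integral_eq_lintegral_ofReal (hg.norm.const_mul _)
    (Filter.Eventually.of_forall fun x => by positivity)]
  refine lintegral_mono fun x => ?_
  calc _ ≤ ∫⁻ D, ENNReal.ofReal (2 * cψ * ‖g x‖) ∂P := by
        refine lintegral_mono fun D => ENNReal.ofReal_le_ofReal ?_
        refine (real_inner_le_norm _ _).trans (mul_le_mul_of_nonneg_right ?_ (norm_nonneg _))
        have := norm_sub_le (ψ (fn D x)) (ψ (fstar x))
        linarith [hψ (fn D x), hψ (fstar x)]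
    _ = _ := by simp


/-- **Nearest neighbors fast rates under the low-density assumption**: under the Tsybakov
margin condition with exponent `α`, the sub-exponential moment condition and the modified
Lipschitz condition, the `k_n`-nearest-neighbor plug-in estimator with
`k_n = ⌊k₀ n^{2β/(2β+1)}⌋` achieves the rate `n^{−β(α+1)/(2β+1)}`. -/
theorem nearest_neighbors_low_density
    (ψ : Z → H) (φ : Y → H) (cψ : ℝ) (hψ : ∀ z, ‖ψ z‖ ≤ cψ) (hφ : Measurable φ)
    (μ : Measure X) [IsProbabilityMeasure μ] (κ : Kernel X Y) [IsMarkovKernel κ]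
    (hφ2 : Integrable (fun p : X × Y => ‖φ p.2‖ ^ 2) (μ ⊗ₘ κ))
    (α cα : ℝ) (hα : 0 < α) (hcα : 0 < cα)
    (hlowdensity : ∀ t : ℝ, 0 < t →
      μ {x | dF ψ (gStar φ κ x) < ENNReal.ofReal t} ≤ ENNReal.ofReal (cα * t ^ α))
    (σ2 M : ℝ) (hσ2 : 0 < σ2) (hM : 0 < M)
    (hmoment : ∀ x ∈ msupp μ, ∀ m : ℕ, 2 ≤ m →
      ∫⁻ y, (‖φ y - gStar φ κ x‖₊ : ℝ≥0∞) ^ m ∂(κ x)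
        ≤ ENNReal.ofReal ((1 / 2) * m.factorial * σ2 * M ^ (m - 2)))
    (β cβ : ℝ) (hβ : 0 < β) (hcβ : 0 < cβ)
    (hlip : ∀ u ∈ msupp μ, ∀ v ∈ msupp μ,
      ‖gStar φ κ u - gStar φ κ v‖ ≤ cβ * (μ (Metric.closedBall u (dist u v))).toReal ^ β)
    (hcdf : ∀ x ∈ msupp μ, Continuous fun t : ℝ => (μ {u | dist x u ≤ t}).toReal)
    (fstar : X → Z) (hfstar : IsDecoding ψ (gStar φ κ) fstar)
    (k₀ : ℝ) (hk₀ : 0 < k₀) :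
    ∃ b₆ : ℝ, 0 < b₆ ∧
      ∀ n : ℕ, 1 ≤ n →
      ∀ fn : (Fin n → X × Y) → X → Z,
        (∀ D, IsDecoding ψ (gNN φ n ⌊k₀ * (n : ℝ) ^ (2 * β / (2 * β + 1))⌋₊ D) (fn D)) →
        Measurable (Function.uncurry fn) →
        (∫ D, risk ψ φ (μ ⊗ₘ κ) (fn D) ∂(Measure.pi fun _ : Fin n => μ ⊗ₘ κ))
            - risk ψ φ (μ ⊗ₘ κ) fstar
          ≤ b₆ * (n : ℝ) ^ (-(β * (α + 1)) / (2 * β + 1)) := by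
  obtain ⟨z₀⟩ := (inferInstance : Nonempty Z)
  have hc : 0 ≤ cψ := (norm_nonneg _).trans (hψ z₀)
  have hφ1 : Integrable (fun p : X × Y => φ p.2) (μ ⊗ₘ κ) := by
    have hm : Measurable (fun p : X × Y => φ p.2) := by fun_prop
    exact ((memLp_two_iff_integrable_sq_norm hm.aestronglyMeasurable).2 hφ2).integrable one_le_two
  have hgm := nn_gStar_measurable φ hφ κ
  have hg := nn_gStar_integrable φ hφ μ κ hφ1
  obtain ⟨p, hp⟩ := exists_nat_ge (α + 2)
  obtain ⟨K, hK, n₀, htail⟩ := nn_tail φ hφ μ κ σ2 M hσ2 hM hmoment β cβ hβ hcβ hlip hcdf k₀ hk₀ p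
  set C : ℝ := 2 * cψ * ((K + 1) * 2 ^ p) * cα * 2 with hC
  set C0 : ℝ := ∫ x, 2 * cψ * ‖gStar φ κ x‖ ∂μ with hC0
  have hCn : 0 ≤ C := by positivity
  have hC0n : 0 ≤ C0 := integral_nonneg fun x => by positivity
  set e : ℝ := β * (α + 1) / (2 * β + 1) with he
  have he0 : 0 < e := by positivity
  refine ⟨C + C0 * (n₀ : ℝ) ^ e + 1, by positivity, fun n hn fn hfn hfnm => ?_⟩
  have hn0 : (0 : ℝ) < n := by exact_mod_cast hn
  rw [show -(β * (α + 1)) / (2 * β + 1) = -e by rw [he]; ring]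
  have hne : 0 < (n : ℝ) ^ (-e) := rpow_pos_of_pos hn0 _
  have hlhs := nn_lhs_eq ψ φ hφ μ κ hφ1 cψ hψ fstar hfstar n fn hfnm
  by_cases hnn : n₀ ≤ n
  · set δ : ℝ := (n : ℝ) ^ (-β / (2 * β + 1)) with hδ
    have hδ0 : 0 < δ := rpow_pos_of_pos hn0 _
    have hδe : δ ^ (α + 1) = (n : ℝ) ^ (-e) := by
      rw [hδ, ← rpow_mul hn0.le]
      congr 1
      rw [he]; ring
    have hmain := nn_outer ψ cψ hc μ (gStar φ κ) hgm α cα hα hcα hlowdensity p hp δ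
      ((K + 1) * 2 ^ p) hδ0 (by positivity)
    have hbd : (∫ D, risk ψ φ (μ ⊗ₘ κ) (fn D) ∂(Measure.pi fun _ : Fin n => μ ⊗ₘ κ))
            - risk ψ φ (μ ⊗ₘ κ) fstar ≤ C * (n : ℝ) ^ (-e) := by
      rw [← ENNReal.ofReal_le_ofReal_iff (by positivity), hlhs]
      refine le_trans (lintegral_mono_ae ?_) (hmain.trans (le_of_eq ?_))
      · filter_upwards [nn_msupp_ae μ] with x hx
        exact nn_inner_bound ψ φ cψ hψ hφ n _ p _ x (gStar φ κ x) (fstar x) (hfstar.2 x)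
          (fun D => fn D x) (fun D z => (hfn D).2 x z) δ K hδ0 hK (htail n hnn x hx)
      · rw [hδe, hC]
        congr 1
        ring
    refine hbd.trans (mul_le_mul_of_nonneg_right ?_ hne.le)
    have : 0 ≤ C0 * (n₀ : ℝ) ^ e := by positivity
    linarith
  · have hbd : (∫ D, risk ψ φ (μ ⊗ₘ κ) (fn D) ∂(Measure.pi fun _ : Fin n => μ ⊗ₘ κ))
            - risk ψ φ (μ ⊗ₘ κ) fstar ≤ C0 := by
      rw [← ENNReal.ofReal_le_ofReal_iff hC0n, hlhs]
      exact nn_trivial_bound ψ cψ hc hψ μ (gStar φ κ) hg _ fn fstar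
    refine hbd.trans ?_
    have hle : (n : ℝ) ^ e ≤ (n₀ : ℝ) ^ e :=
      rpow_le_rpow hn0.le (by exact_mod_cast (not_le.1 hnn).le) he0.le
    calc C0 = C0 * (n : ℝ) ^ e * (n : ℝ) ^ (-e) := by
          rw [mul_assoc, ← rpow_add hn0, add_neg_cancel, rpow_zero, mul_one]
      _ ≤ (C + C0 * (n₀ : ℝ) ^ e + 1) * (n : ℝ) ^ (-e) := by
          refine mul_le_mul_of_nonneg_right ?_ hne.le
          have := mul_le_mul_of_nonneg_left hle hC0n
          linarith

end
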